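/- arXiv:0712.1237 — 2 statements merged into one kernel-verified Lean document; each statement's English description precedes it below -/
import Mathlib

section
/- Let 0 < m < n. Then every two-sided orbit of U_{(m)} on 𝔫_{(m)}* contains exactly one path supercharacter representative; that is, for each λ ∈ 𝔫_{(m)}* there is a unique path supercharacter representative μ with μ ∈ U_{(m)}λU_{(m)}. -/
open Matrix BigOperators
open scoped Classical

/-- `n × n` matrices over `F`. -/
abbrev Mat (n : ℕ) (F : Type*) := Matrix (Fin n) (Fin n) F

section Defs

variable {n : ℕ} {F : Type*} [Field F] [Fintype F]

/-- The pattern group `U_P` attached to a relation `P` on `{0,…,n-1}`: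
unipotent upper-triangular matrices supported (off the diagonal) on positions `(i,j)` with `P i j`. -/
def patGroup (P : Fin n → Fin n → Prop) : Set (Mat n F) :=
  {u | (∀ i, u i i = 1) ∧ ∀ i j, i ≠ j → ¬ P i j → u i j = 0}

/-- Truncation of a matrix to the positions allowed by `P` (used to identify a functional on
`𝔫_P` with the matrix of its coefficients on allowable positions). -/
noncomputable def truncP (P : Fin n → Fin n → Prop) (A : Mat n F) : Mat n F :=
  Matrix.of fun i j => if P i j then A i j else 0

/-- The left orbit `U_P λ` of the functional (identified with a matrix) `lam`:
`(aλ)(x) = λ(a⁻¹ x)`, whose coefficient matrix is the truncation of `(a⁻¹)ᵀ * λ`. -/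
noncomputable def dualLeftOrbit (P : Fin n → Fin n → Prop) (lam : Mat n F) : Set (Mat n F) :=
  {mu | ∃ a ∈ (patGroup P : Set (Mat n F)), mu = truncP P ((a⁻¹)ᵀ * lam)}

/-- The two-sided orbit `U_P λ U_P` of the functional `lam`: `(aλb)(x) = λ(a⁻¹ x b⁻¹)`,
whose coefficient matrix is the truncation of `(a⁻¹)ᵀ * λ * (b⁻¹)ᵀ`. -/
noncomputable def dualOrbit (P : Fin n → Fin n → Prop) (lam : Mat n F) : Set (Mat n F) :=
  {mu | ∃ a ∈ (patGroup P : Set (Mat n F)), ∃ b ∈ (patGroup P : Set (Mat n F)),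
    mu = truncP P ((a⁻¹)ᵀ * lam * (b⁻¹)ᵀ)}

/-- The two-sided superclass orbit `{a (v-1) b : a, b ∈ U_P}` attached to `v ∈ U_P`. -/
def classOrbit (P : Fin n → Fin n → Prop) (v : Mat n F) : Set (Mat n F) :=
  {x | ∃ a ∈ (patGroup P : Set (Mat n F)), ∃ b ∈ (patGroup P : Set (Mat n F)),
    x = a * (v - 1) * b}

/-- The pairing `λ(x) = Σ_{i,j} λ_{ij} x_{ij}` of a functional-matrix with a matrix. -/
def pairM (A B : Mat n F) : F := ∑ i, ∑ j, A i j * B i j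

/-- The supercharacter `χ^λ` of the pattern group `U_P` attached to the functional `lam`:
`χ^λ(u) = (|U_Pλ|/|U_PλU_P|) Σ_{μ ∈ U_PλU_P} θ(−μ(u−1))`. -/
noncomputable def superChar (P : Fin n → Fin n → Prop) (θ : AddChar F ℂ)
    (lam u : Mat n F) : ℂ :=
  ((dualLeftOrbit P lam).ncard : ℂ) / ((dualOrbit P lam).ncard : ℂ) *
    ∑ᶠ mu ∈ dualOrbit P lam, θ (- pairM mu (u - 1))

/-- The full order `i < j`, whose pattern group is `U_n`. -/
def Plt (n : ℕ) : Fin n → Fin n → Prop := fun i j => i < j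

/-- The poset `𝒫_(m)` (in 0-based indexing): `i < j`, except that row `0` (row `1` in 1-based
indexing) is only comparable to columns `j` with 1-based value `j+1 > m`.  Its pattern group is
the interpolating group `U_(m)`. -/
def Pm (n m : ℕ) : Fin n → Fin n → Prop := fun i j => i < j ∧ (i.val = 0 → m < j.val + 1)

/-- `𝒮_n(q)`: strictly upper-triangular matrices with at most one nonzero entry in each row
and each column. -/
def Sset (n : ℕ) (F : Type*) [Field F] : Set (Mat n F) :=
  {lam | (∀ i j : Fin n, ¬ i < j → lam i j = 0) ∧
    (∀ (i j j' : Fin n), lam i j ≠ 0 → lam i j' ≠ 0 → j = j') ∧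
    (∀ (i i' j : Fin n), lam i j ≠ 0 → lam i' j ≠ 0 → i = i')}

/-- Adjacency of two nonzero positions of `A` (they share a row or a column): the edges of
the graph `G_A`. -/
def adjRel (A : Mat n F) (p q : Fin n × Fin n) : Prop :=
  p ≠ q ∧ A p.1 p.2 ≠ 0 ∧ A q.1 q.2 ≠ 0 ∧ (p.1 = q.1 ∨ p.2 = q.2)

/-- The connected component of the position `p` in the graph `G_A`. -/
def compOf (A : Mat n F) (p : Fin n × Fin n) : Set (Fin n × Fin n) :=
  {q | Relation.ReflTransGen (adjRel A) p q}

/-- The set of connected components of the graph `G_A`. -/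
def comps (A : Mat n F) : Set (Set (Fin n × Fin n)) :=
  {S | ∃ p : Fin n × Fin n, A p.1 p.2 ≠ 0 ∧ S = compOf A p}

/-- The matrix agreeing with `A` on the positions of `S` and vanishing elsewhere. -/
noncomputable def restrictTo (S : Set (Fin n × Fin n)) (A : Mat n F) : Mat n F :=
  Matrix.of fun i j => if (i, j) ∈ S then A i j else 0

/-- At most one connected component of `G_A` has more than one vertex. -/
def AtMostOneBig (A : Mat n F) : Prop :=
  ∀ p q : Fin n × Fin n, A p.1 p.2 ≠ 0 → A q.1 q.2 ≠ 0 →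
    1 < (compOf A p).ncard → 1 < (compOf A q).ncard → compOf A p = compOf A q

end Defs

section Reps

variable {n : ℕ} {F : Type*} [Field F] [Fintype F]

/-- The vertex-set shape (in 1-based coordinates `(v.1.val + 1, v.2.val + 1)`) of the large
connected component of a comb superclass representative:
`{(1,k_1),…,(1,k_r)} ∪ {(i_1,k_1),…,(i_{r'},k_{r'})}` with
`1 ≤ i_{r'} < ⋯ < i_1 ≤ m < k_1 < ⋯ < k_r ≤ n` and `r' ∈ {r−1, r}`. -/
def CombClassComp (m : ℕ) (S : Set (Fin n × Fin n)) : Prop :=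
  ∃ r r' : ℕ, (r' = r ∨ r' + 1 = r) ∧ 1 ≤ r' ∧
    ∃ i k : ℕ → ℕ,
      (∀ d, 1 ≤ d → d < r' → i (d + 1) < i d) ∧ 1 ≤ i r' ∧ i 1 ≤ m ∧
      m < k 1 ∧ (∀ d, 1 ≤ d → d < r → k d < k (d + 1)) ∧ k r ≤ n ∧
      S = {v : Fin n × Fin n |
        (v.1.val + 1 = 1 ∧ ∃ d, 1 ≤ d ∧ d ≤ r ∧ v.2.val + 1 = k d) ∨
        (∃ d, 1 ≤ d ∧ d ≤ r' ∧ v.1.val + 1 = i d ∧ v.2.val + 1 = k d)}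

/-- `u ∈ U_(m)` is a comb superclass representative (the condition is on `A = u − 1`):
at most one connected component of `G_A` has more than one vertex, and any such component has
the comb shape. -/
def IsCombClassRep (m : ℕ) (A : Mat n F) : Prop :=
  AtMostOneBig A ∧
    ∀ p : Fin n × Fin n, A p.1 p.2 ≠ 0 → 1 < (compOf A p).ncard →
      CombClassComp m (compOf A p)

/-- The vertex-set shape of the large connected component of a path superclass representative:
`{(1,k_1)} ∪ {(i_d,k_d) : 1 ≤ d ≤ r−1} ∪ {(i_d,k_{d+1}) : 1 ≤ d ≤ r−1} ∪ E` with `E = ∅` or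
`E = {(i_r,k_r)}`, where `1 < i_{r'} < ⋯ < i_1 ≤ m < k_1 < ⋯ < k_r ≤ n`, and `r' = r` if
`E ≠ ∅`, `r' = r − 1` if `E = ∅` (`e : Bool` records whether `E ≠ ∅`). -/
def PathClassComp (m : ℕ) (S : Set (Fin n × Fin n)) : Prop :=
  ∃ (r : ℕ) (e : Bool) (i k : ℕ → ℕ),
    1 ≤ r ∧
    (∀ d, 1 ≤ d → d < (if e then r else r - 1) → i (d + 1) < i d) ∧
    1 < i (if e then r else r - 1) ∧ i 1 ≤ m ∧
    m < k 1 ∧ (∀ d, 1 ≤ d → d < r → k d < k (d + 1)) ∧ k r ≤ n ∧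
    S = {v : Fin n × Fin n |
      (v.1.val + 1 = 1 ∧ v.2.val + 1 = k 1) ∨
      (∃ d, 1 ≤ d ∧ d ≤ r - 1 ∧ v.1.val + 1 = i d ∧ v.2.val + 1 = k d) ∨
      (∃ d, 1 ≤ d ∧ d ≤ r - 1 ∧ v.1.val + 1 = i d ∧ v.2.val + 1 = k (d + 1)) ∨
      (e = true ∧ v.1.val + 1 = i r ∧ v.2.val + 1 = k r)}

/-- `u ∈ U_(m)` is a path superclass representative (the condition is on `A = u − 1`). -/
def IsPathClassRep (m : ℕ) (A : Mat n F) : Prop :=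
  AtMostOneBig A ∧
    ∀ p : Fin n × Fin n, A p.1 p.2 ≠ 0 → 1 < (compOf A p).ncard →
      PathClassComp m (compOf A p)

/-- The vertex-set shape of the large connected component of a comb supercharacter
representative: `{(1,k_1)} ∪ {(i_d,k_{d+1}) : 1 ≤ d ≤ r−1} ∪ {(i_d,k_1) : 1 ≤ d ≤ r'}` with
`n ≥ k_1 > k_2 > ⋯ > k_r > m ≥ i_{r'} > ⋯ > i_1 > 1` and `r' ∈ {r−1, r}`. -/
def CombCharComp (m : ℕ) (S : Set (Fin n × Fin n)) : Prop :=
  ∃ r r' : ℕ, (r' = r ∨ r' + 1 = r) ∧ 1 ≤ r' ∧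
    ∃ i k : ℕ → ℕ,
      (∀ d, 1 ≤ d → d < r → k (d + 1) < k d) ∧ m < k r ∧ k 1 ≤ n ∧
      (∀ d, 1 ≤ d → d < r' → i d < i (d + 1)) ∧ i r' ≤ m ∧ 1 < i 1 ∧
      S = {v : Fin n × Fin n |
        (v.1.val + 1 = 1 ∧ v.2.val + 1 = k 1) ∨
        (∃ d, 1 ≤ d ∧ d ≤ r - 1 ∧ v.1.val + 1 = i d ∧ v.2.val + 1 = k (d + 1)) ∨
        (∃ d, 1 ≤ d ∧ d ≤ r' ∧ v.1.val + 1 = i d ∧ v.2.val + 1 = k 1)}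

/-- `λ ∈ 𝔫_(m)^*` is a comb supercharacter representative. -/
def IsCombCharRep (m : ℕ) (A : Mat n F) : Prop :=
  AtMostOneBig A ∧
    ∀ p : Fin n × Fin n, A p.1 p.2 ≠ 0 → 1 < (compOf A p).ncard →
      CombCharComp m (compOf A p)

/-- The vertex-set shape of the large connected component of a path supercharacter
representative: `{(1,k_1)} ∪ {(i_d,k_d) : 1 ≤ d ≤ r−1} ∪ {(i_d,k_{d+1}) : 1 ≤ d ≤ r−1} ∪ E`
with `E = ∅` or `E = {(i_r,k_r)}`, where `n ≥ k_1 > ⋯ > k_r > m ≥ i_{r'} > ⋯ > i_1 > 1`, and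
`r' = r` if `E ≠ ∅`, `r' = r − 1` if `E = ∅`. -/
def PathCharComp (m : ℕ) (S : Set (Fin n × Fin n)) : Prop :=
  ∃ (r : ℕ) (e : Bool) (i k : ℕ → ℕ),
    1 ≤ r ∧
    (∀ d, 1 ≤ d → d < r → k (d + 1) < k d) ∧ m < k r ∧ k 1 ≤ n ∧
    (∀ d, 1 ≤ d → d < (if e then r else r - 1) → i d < i (d + 1)) ∧
    i (if e then r else r - 1) ≤ m ∧ 1 < i 1 ∧
    S = {v : Fin n × Fin n |
      (v.1.val + 1 = 1 ∧ v.2.val + 1 = k 1) ∨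
      (∃ d, 1 ≤ d ∧ d ≤ r - 1 ∧ v.1.val + 1 = i d ∧ v.2.val + 1 = k d) ∨
      (∃ d, 1 ≤ d ∧ d ≤ r - 1 ∧ v.1.val + 1 = i d ∧ v.2.val + 1 = k (d + 1)) ∨
      (e = true ∧ v.1.val + 1 = i r ∧ v.2.val + 1 = k r)}

/-- `λ ∈ 𝔫_(m)^*` is a path supercharacter representative. -/
def IsPathCharRep (m : ℕ) (A : Mat n F) : Prop :=
  AtMostOneBig A ∧
    ∀ p : Fin n × Fin n, A p.1 p.2 ≠ 0 → 1 < (compOf A p).ncard →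
      PathCharComp m (compOf A p)

end Reps

section Orbits

variable {n m : ℕ} {F : Type*} [Field F]

lemma Pm.lt {i j : Fin n} (h : Pm n m i j) : i < j := h.1

lemma Pm.trans {i j k : Fin n} (hij : Pm n m i j) (hjk : Pm n m j k) : Pm n m i k := by
  obtain ⟨h1, h2⟩ := hij
  obtain ⟨h3, -⟩ := hjk
  refine ⟨h1.trans h3, fun h => ?_⟩
  have := h2 h
  have : j.val < k.val := h3
  omega

/-- A functional on `𝔫_(m)`: a matrix vanishing outside the positions allowed by `Pm`. -/
def IsFunctional (m : ℕ) (A : Mat n F) : Prop := ∀ i j, ¬ Pm n m i j → A i j = 0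

lemma isFunctional_truncP (A : Mat n F) : IsFunctional m (truncP (Pm n m) A) := by
  intro i j h
  simp [truncP, h]

lemma IsFunctional.pm {A : Mat n F} (hA : IsFunctional m A) {i j : Fin n} (h : A i j ≠ 0) :
    Pm n m i j := by
  by_contra h'
  exact h (hA i j h')

lemma IsFunctional.truncP_eq {A : Mat n F} (hA : IsFunctional m A) :
    truncP (Pm n m) A = A := by
  ext i j
  by_cases h : Pm n m i j <;> simp [truncP, h]
  exact (hA i j h).symm

/-- The transposes of the elements of the pattern group `U_(m)`. -/
def IsLower (m : ℕ) (A : Mat n F) : Prop :=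
  (∀ i, A i i = 1) ∧ ∀ i j, i ≠ j → ¬ Pm n m j i → A i j = 0

lemma IsLower.cases {A : Mat n F} (hA : IsLower m A) {i j : Fin n} (h : A i j ≠ 0) :
    i = j ∨ Pm n m j i := by
  by_contra! h'
  exact h (hA.2 i j h'.1 h'.2)

lemma isLower_one : IsLower m (1 : Mat n F) :=
  ⟨fun i => by simp, fun i j h _ => by simp [h]⟩

lemma IsLower.mul {A B : Mat n F} (hA : IsLower m A) (hB : IsLower m B) :
    IsLower m (A * B) := by
  constructor
  · intro i
    rw [Matrix.mul_apply, Finset.sum_eq_single i]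
    · rw [hA.1, hB.1, one_mul]
    · intro k _ hk
      by_contra h
      rcases hA.cases (left_ne_zero_of_mul h) with h1 | h1
      · exact hk h1.symm
      rcases hB.cases (right_ne_zero_of_mul h) with h2 | h2
      · exact hk h2
      exact lt_asymm h1.lt h2.lt
    · simp
  · intro i j hij hP
    rw [Matrix.mul_apply]
    refine Finset.sum_eq_zero fun k _ => ?_
    by_contra h
    rcases hA.cases (left_ne_zero_of_mul h) with h1 | h1 <;>
      rcases hB.cases (right_ne_zero_of_mul h) with h2 | h2
    · exact hij (h1.trans h2)
    · exact hP (h1 ▸ h2)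
    · exact hP (h2 ▸ h1)
    · exact hP (h2.trans h1)

lemma IsLower.pow {A : Mat n F} (hA : IsLower m A) (N : ℕ) : IsLower m (A ^ N) := by
  induction N with
  | zero => simpa using isLower_one
  | succ N ih => rw [pow_succ]; exact ih.mul hA

lemma IsLower.isUnit {A : Mat n F} (hA : IsLower m A) : IsUnit A := by
  rw [Matrix.isUnit_iff_isUnit_det, Matrix.det_of_isLowerTriangular A]
  · simp [hA.1]
  · intro i j hij
    have hij' : i < j := hij
    exact hA.2 i j hij'.ne fun h => lt_asymm h.lt hij'

lemma IsLower.inv [Finite F] {A : Mat n F} (hA : IsLower m A) : IsLower m A⁻¹ := by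
  obtain ⟨u, rfl⟩ := hA.isUnit
  obtain ⟨N, hN, h⟩ := (isOfFinOrder_of_finite u).exists_pow_eq_one
  have : u⁻¹ = u ^ (N - 1) := by
    rw [inv_eq_iff_mul_eq_one, ← pow_succ', Nat.sub_add_cancel hN, h]
  rw [← Matrix.coe_units_inv, this, Units.val_pow_eq_pow_val]
  exact hA.pow _

lemma isLower_transpose_iff {A : Mat n F} : IsLower m Aᵀ ↔ A ∈ patGroup (Pm n m) := by
  constructor
  · rintro ⟨h1, h2⟩
    exact ⟨h1, fun i j hij h => h2 j i hij.symm h⟩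
  · rintro ⟨h1, h2⟩
    exact ⟨h1, fun i j hij h => h2 j i hij.symm h⟩

/-- `ν` lies in the two-sided orbit of `μ`. -/
def OrbitRel (m : ℕ) (μ ν : Mat n F) : Prop :=
  ∃ A B : Mat n F, IsLower m A ∧ IsLower m B ∧ ν = truncP (Pm n m) (A * μ * B)

lemma mem_dualOrbit_iff [Finite F] {μ ν : Mat n F} :
    ν ∈ dualOrbit (Pm n m) μ ↔ OrbitRel m μ ν := by
  constructor
  · rintro ⟨a, ha, b, hb, rfl⟩
    refine ⟨_, _, ?_, ?_, rfl⟩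
    · rw [Matrix.transpose_nonsing_inv]
      exact (isLower_transpose_iff.2 ha).inv
    · rw [Matrix.transpose_nonsing_inv]
      exact (isLower_transpose_iff.2 hb).inv
  · rintro ⟨A, B, hA, hB, rfl⟩
    have key : ∀ C : Mat n F, IsLower m C →
        (C⁻¹)ᵀ ∈ patGroup (Pm n m) ∧ (((C⁻¹)ᵀ)⁻¹)ᵀ = C := by
      intro C hC
      refine ⟨isLower_transpose_iff.1 (by simpa using hC.inv), ?_⟩
      rw [Matrix.transpose_nonsing_inv, Matrix.transpose_transpose,
        Matrix.nonsing_inv_nonsing_inv _ ((Matrix.isUnit_iff_isUnit_det _).1 hC.isUnit)]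
    exact ⟨_, (key A hA).1, _, (key B hB).1, by rw [(key A hA).2, (key B hB).2]⟩

lemma truncP_mul_truncP {A B : Mat n F} (hA : IsLower m A) (hB : IsLower m B) (M : Mat n F) :
    truncP (Pm n m) (A * truncP (Pm n m) M * B) = truncP (Pm n m) (A * M * B) := by
  ext i j
  by_cases hij : Pm n m i j
  · simp only [truncP, Matrix.of_apply, hij, if_true, Matrix.mul_apply]
    refine Finset.sum_congr rfl fun l _ => ?_
    by_cases hl : B l j = 0
    · simp [hl]
    congr 1
    refine Finset.sum_congr rfl fun k _ => ?_
    by_cases hk : A i k = 0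
    · simp [hk]
    have h1 : Pm n m k j := by
      rcases hA.cases hk with h | h
      · exact h ▸ hij
      · exact h.trans hij
    have h2 : Pm n m k l := by
      rcases hB.cases hl with h | h
      · exact h ▸ h1
      · exact h1.trans h
    simp [h2]
  · simp [truncP, hij]

lemma OrbitRel.refl {μ : Mat n F} (hμ : IsFunctional m μ) : OrbitRel m μ μ :=
  ⟨1, 1, isLower_one, isLower_one, by simp [hμ.truncP_eq]⟩

lemma OrbitRel.trans {μ ν ξ : Mat n F} (h1 : OrbitRel m μ ν) (h2 : OrbitRel m ν ξ) :
    OrbitRel m μ ξ := by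
  obtain ⟨A, B, hA, hB, rfl⟩ := h1
  obtain ⟨A', B', hA', hB', rfl⟩ := h2
  refine ⟨A' * A, B * B', hA'.mul hA, hB.mul hB', ?_⟩
  rw [truncP_mul_truncP hA' hB']
  simp only [Matrix.mul_assoc]

lemma OrbitRel.symm [Finite F] {μ ν : Mat n F} (hμ : IsFunctional m μ) (h : OrbitRel m μ ν) :
    OrbitRel m ν μ := by
  obtain ⟨A, B, hA, hB, rfl⟩ := h
  refine ⟨A⁻¹, B⁻¹, hA.inv, hB.inv, ?_⟩
  have h1 := (Matrix.isUnit_iff_isUnit_det _).1 hA.isUnit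
  have h2 := (Matrix.isUnit_iff_isUnit_det _).1 hB.isUnit
  rw [truncP_mul_truncP hA.inv hB.inv, Matrix.mul_assoc A, ← Matrix.mul_assoc A⁻¹,
    Matrix.nonsing_inv_mul _ h1, Matrix.one_mul, Matrix.mul_assoc, Matrix.mul_nonsing_inv _ h2,
    Matrix.mul_one, hμ.truncP_eq]

end Orbits

section Forms

variable {n m : ℕ} {F : Type*} [Field F]

/-- The first `t` rows of `μ` consist of isolated entries together with a path through the
positions `(ρ 0, κ 0), (ρ 1, κ 0), (ρ 1, κ 1), (ρ 2, κ 1), …`, using `r` columns and `s` rows. -/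
structure PathForm (m t : ℕ) (μ : Mat n F) (r s : ℕ) (ρ κ : ℕ → Fin n) : Prop where
  length : s = r ∨ (s = r + 1 ∧ 0 < r)
  row_zero : 0 < r → (ρ 0).val = 0
  row_lt : ∀ d, d < s → (ρ d).val < t
  row_lt_m : ∀ d, d < s → (ρ d).val < m
  row_mono : ∀ d e, d < e → e < s → ρ d < ρ e
  col_anti : ∀ d e, d < e → e < r → κ e < κ d
  col_ge : ∀ d, d < r → m ≤ (κ d).val
  diag : ∀ d, d < r → μ (ρ d) (κ d) ≠ 0
  sub : ∀ d, d + 1 < s → μ (ρ (d + 1)) (κ d) ≠ 0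
  cover : ∀ i j, i.val < t → μ i j ≠ 0 →
    (∃ d, d < r ∧ i = ρ d ∧ j = κ d) ∨ (∃ d, d + 1 < s ∧ i = ρ (d + 1) ∧ j = κ d) ∨
    ((∀ j', μ i j' ≠ 0 → j' = j) ∧ (∀ i', i'.val < t → μ i' j ≠ 0 → i' = i))

namespace PathForm

variable {t r s : ℕ} {μ : Mat n F} {ρ κ : ℕ → Fin n}

lemma le_length (h : PathForm m t μ r s ρ κ) : r ≤ s := by
  rcases h.length with h | h <;> omega

lemma length_le (h : PathForm m t μ r s ρ κ) : s ≤ r + 1 := by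
  rcases h.length with h | h <;> omega

lemma row_inj (h : PathForm m t μ r s ρ κ) {d e : ℕ} (hd : d < s) (he : e < s)
    (hde : ρ d = ρ e) : d = e := by
  rcases lt_trichotomy d e with hlt | heq | hlt
  · exact absurd hde (h.row_mono d e hlt he).ne
  · exact heq
  · exact absurd hde (h.row_mono e d hlt hd).ne'

lemma col_inj (h : PathForm m t μ r s ρ κ) {d e : ℕ} (hd : d < r) (he : e < r)
    (hde : κ d = κ e) : d = e := by
  rcases lt_trichotomy d e with hlt | heq | hlt
  · exact absurd hde (h.col_anti d e hlt he).ne'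
  · exact heq
  · exact absurd hde (h.col_anti e d hlt hd).ne

lemma row_entry (h : PathForm m t μ r s ρ κ) {d : ℕ} (hd : d < s) {j : Fin n}
    (hj : μ (ρ d) j ≠ 0) : (d < r ∧ j = κ d) ∨ ∃ e, d = e + 1 ∧ j = κ e := by
  rcases h.cover _ j (h.row_lt d hd) hj with ⟨e, he, h1, h2⟩ | ⟨e, he, h1, h2⟩ | ⟨h1, -⟩
  · have := h.row_inj hd (he.trans_le h.le_length) h1
    subst this
    exact Or.inl ⟨he, h2⟩
  · exact Or.inr ⟨e, h.row_inj hd he h1, h2⟩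
  · by_cases hdr : d < r
    · exact Or.inl ⟨hdr, (h1 _ (h.diag d hdr)).symm⟩
    · have := h.length
      obtain ⟨e, rfl⟩ : ∃ e, d = e + 1 := ⟨d - 1, by omega⟩
      exact Or.inr ⟨e, rfl, (h1 _ (h.sub e hd)).symm⟩

lemma col_entry (h : PathForm m t μ r s ρ κ) {d : ℕ} (hd : d < r) {i : Fin n} (hi : i.val < t)
    (hj : μ i (κ d) ≠ 0) : i = ρ d ∨ (d + 1 < s ∧ i = ρ (d + 1)) := by
  rcases h.cover i _ hi hj with ⟨e, he, h1, h2⟩ | ⟨e, he, h1, h2⟩ | ⟨-, h1⟩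
  · have := h.col_inj hd he h2
    subst this
    exact Or.inl h1
  · have := h.col_inj hd (by have := h.length_le; omega) h2
    subst this
    exact Or.inr ⟨he, h1⟩
  · exact Or.inl (h1 _ (h.row_lt d (hd.trans_le h.le_length)) (h.diag d hd)).symm

lemma congr (h : PathForm m t μ r s ρ κ) {μ' : Mat n F}
    (hμ : ∀ i j, i.val < t → μ' i j = μ i j) : PathForm m t μ' r s ρ κ where
  length := h.length
  row_zero := h.row_zero
  row_lt := h.row_lt
  row_lt_m := h.row_lt_m
  row_mono := h.row_mono
  col_anti := h.col_anti
  col_ge := h.col_ge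
  diag d hd := by
    rw [hμ _ _ (h.row_lt d (hd.trans_le h.le_length))]
    exact h.diag d hd
  sub d hd := by
    rw [hμ _ _ (h.row_lt _ hd)]
    exact h.sub d hd
  cover i j hi hij := by
    rw [hμ i j hi] at hij
    rcases h.cover i j hi hij with h1 | h1 | ⟨h1, h2⟩
    · exact Or.inl h1
    · exact Or.inr (Or.inl h1)
    · refine Or.inr (Or.inr ⟨fun j' hj' => h1 j' ?_, fun i' hi' hj' => h2 i' hi' ?_⟩)
      · rwa [← hμ _ _ hi]
      · rwa [← hμ _ _ hi']

end PathForm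

/-- At a nonzero entry of a path form, an infinitesimal two-sided move that fixes all positions
weakly above and to the right also fixes the entry. -/
lemma PathForm.sum_eq_sum {r s : ℕ} {ν : Mat n F} {ρ κ : ℕ → Fin n}
    (h : PathForm m n ν r s ρ κ) (hν : IsFunctional m ν) {X Y : Mat n F}
    (hX : ∀ i k, X i k ≠ 0 → Pm n m k i) (hY : ∀ k j, Y k j ≠ 0 → Pm n m j k)
    {i j : Fin n} (hij : ν i j ≠ 0)
    (heq : ∀ i' j', i' ≤ i → j ≤ j' → (i', j') ≠ (i, j) → Pm n m i' j' →
      ∑ k, X i' k * ν k j' = ∑ k, ν i' k * Y k j') :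
    ∑ k, X i k * ν k j = ∑ k, ν i k * Y k j := by
  have hlt := hν.pm hij
  have hrs := h.le_length
  have hsr := h.length_le
  suffices hs : (∀ k, X i k ≠ 0 → ν k j = 0) ∧ (∀ k, ν i k ≠ 0 → Y k j = 0) by
    rw [Finset.sum_eq_zero, Finset.sum_eq_zero]
    · intro k _
      by_cases hk : ν i k = 0
      · simp [hk]
      · simp [hs.2 k hk]
    · intro k _
      by_cases hk : X i k = 0
      · simp [hk]
      · simp [hs.1 k hk]
  rcases h.cover i j i.2 hij with ⟨d, hd, rfl, rfl⟩ | ⟨d, hd, rfl, rfl⟩ | ⟨h1, h2⟩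
  · -- the column has no entry above, and the equations on the path above kill `Y`
    have hcol : ∀ k, k < ρ d → ν k (κ d) = 0 := by
      intro k hk
      by_contra hne
      rcases h.col_entry hd k.2 hne with rfl | ⟨h1, rfl⟩
      · exact lt_irrefl _ hk
      · exact lt_asymm hk (h.row_mono d (d + 1) (by omega) h1)
    have hYz : ∀ e, e < d → Y (κ e) (κ d) = 0 := by
      intro e
      induction e with
      | zero =>
        intro he
        have h0 := h.row_mono 0 d he (by omega)
        have hz := h.row_zero (by omega)
        have := heq (ρ 0) (κ d) h0.le le_rfl
          (by intro hc; exact h0.ne (congrArg Prod.fst hc))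
          ⟨lt_of_lt_of_le h0 hlt.lt.le, fun _ => by have := h.col_ge d hd; omega⟩
        rw [Finset.sum_eq_zero, Finset.sum_eq_single (κ 0)] at this
        · rcases mul_eq_zero.1 this.symm with h3 | h3
          · exact absurd h3 (h.diag 0 (by omega))
          · exact h3
        · intro k _ hk
          by_cases hne : ν (ρ 0) k = 0
          · simp [hne]
          rcases h.row_entry (by omega) hne with ⟨-, h3⟩ | ⟨e, h3, -⟩
          · exact absurd h3 hk
          · omega
        · simp
        · intro k _
          by_cases hx : X (ρ 0) k = 0
          · simp [hx]
          · simp [hcol k ((hX _ _ hx).lt.trans h0)]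
      | succ e ih =>
        intro he
        have h0 := h.row_mono (e + 1) d he (by omega)
        have := heq (ρ (e + 1)) (κ d) h0.le le_rfl
          (by intro hc; exact h0.ne (congrArg Prod.fst hc))
          ⟨lt_of_lt_of_le h0 hlt.lt.le, fun _ => by have := h.col_ge d hd; omega⟩
        rw [Finset.sum_eq_zero, Finset.sum_eq_single (κ (e + 1))] at this
        · rcases mul_eq_zero.1 this.symm with h3 | h3
          · exact absurd h3 (h.diag _ (by omega))
          · exact h3
        · intro k _ hk
          by_cases hne : ν (ρ (e + 1)) k = 0
          · simp [hne]
          rcases h.row_entry (by omega) hne with ⟨-, h3⟩ | ⟨e', h3, rfl⟩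
          · exact absurd h3 hk
          · obtain rfl : e' = e := by omega
            simp [ih (by omega)]
        · simp
        · intro k _
          by_cases hx : X (ρ (e + 1)) k = 0
          · simp [hx]
          · simp [hcol k ((hX _ _ hx).lt.trans h0)]
    refine ⟨fun k hk => hcol k (hX _ _ hk).lt, fun k hk => ?_⟩
    rcases h.row_entry (by omega) hk with ⟨-, rfl⟩ | ⟨e, h3, rfl⟩
    · by_contra hne
      exact lt_irrefl _ (hY _ _ hne).lt
    · exact hYz e (by omega)
  · -- the row has no entry to the right, and the equations along the path kill `X`
    have hrow : ∀ k, κ d < k → ν (ρ (d + 1)) k = 0 := by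
      intro k hk
      by_contra hne
      rcases h.row_entry hd hne with ⟨h1, rfl⟩ | ⟨e, h3, rfl⟩
      · exact lt_asymm hk (h.col_anti d (d + 1) (by omega) h1)
      · obtain rfl : d = e := by omega
        exact lt_irrefl _ hk
    have hXz : ∀ e, e ≤ d → X (ρ (d + 1)) (ρ e) = 0 := by
      intro e
      induction e with
      | zero =>
        intro _
        by_contra hne
        have h3 := (hX _ _ hne).2 (h.row_zero (by omega))
        have := h.row_lt_m _ hd
        omega
      | succ e ih =>
        intro he
        have h0 := h.col_anti e d (by omega) (by omega)
        have := heq (ρ (d + 1)) (κ e) le_rfl h0.le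
          (by intro hc; exact h0.ne' (congrArg Prod.snd hc))
          ⟨hlt.lt.trans h0, fun _ => by have := h.col_ge e (by omega); omega⟩
        rw [Finset.sum_eq_single (ρ (e + 1)), Finset.sum_eq_zero] at this
        · rcases mul_eq_zero.1 this with h3 | h3
          · exact h3
          · exact absurd h3 (h.sub _ (by omega))
        · intro k _
          by_cases hy : Y k (κ e) = 0
          · simp [hy]
          · simp [hrow k (h0.trans (hY _ _ hy).lt)]
        · intro k _ hk
          by_cases hne : ν k (κ e) = 0
          · simp [hne]
          rcases h.col_entry (by omega) k.2 hne with rfl | ⟨-, rfl⟩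
          · simp [ih (by omega)]
          · exact absurd rfl hk
        · simp
    refine ⟨fun k hk => ?_, fun k hk => ?_⟩
    · by_contra hne
      rcases h.col_entry (by omega) k.2 hne with rfl | ⟨-, rfl⟩
      · exact hk (hXz d le_rfl)
      · exact lt_irrefl _ (hX _ _ hk).lt
    · by_contra hne
      exact hk (hrow k (hY _ _ hne).lt)
  · refine ⟨fun k hk => ?_, fun k hk => ?_⟩
    · by_contra hne
      obtain rfl := h2 k k.2 hne
      exact lt_irrefl _ (hX _ _ hk).lt
    · by_contra hne
      obtain rfl := h1 k hk
      exact lt_irrefl _ (hY _ _ hne).lt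

lemma PathForm.eq_of_orbitRel [Finite F] {r s r' s' : ℕ} {μ μ' : Mat n F}
    {ρ κ ρ' κ' : ℕ → Fin n}
    (h : PathForm m n μ r s ρ κ) (h' : PathForm m n μ' r' s' ρ' κ')
    (hμ : IsFunctional m μ) (hμ' : IsFunctional m μ') (hrel : OrbitRel m μ μ') : μ = μ' := by
  obtain ⟨A, B, hA, hB, hμ'_eq⟩ := hrel
  have hmul : truncP (Pm n m) (A * μ) = truncP (Pm n m) (μ' * B⁻¹) := by
    have h1 := (Matrix.isUnit_iff_isUnit_det _).1 hB.isUnit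
    have := truncP_mul_truncP isLower_one hB.inv (A * μ * B)
    rw [← hμ'_eq, Matrix.one_mul, Matrix.one_mul, Matrix.mul_assoc (A * μ),
      Matrix.mul_nonsing_inv _ h1, Matrix.mul_one] at this
    exact this.symm
  have hpat : ∀ C : Mat n F, IsLower m C → ∀ i k, (C - 1) i k ≠ 0 → Pm n m k i := by
    intro C hC i k hik
    by_cases hne : i = k
    · subst hne
      simp [hC.1] at hik
    · rcases hC.cases (i := i) (j := k) (by simpa [hne] using hik) with h1 | h1
      · exact absurd h1 hne
      · exact h1
  have hX := hpat A hA
  have hY := hpat _ hB.inv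
  generalize hXdef : A - 1 = X at hX
  generalize hYdef : B⁻¹ - 1 = Y at hY
  have hEq : ∀ i j, Pm n m i j →
      μ i j + ∑ k, X i k * μ k j = μ' i j + ∑ k, μ' i k * Y k j := by
    intro i j hij
    have h1 := congrFun (congrFun hmul i) j
    simp only [truncP, Matrix.of_apply, hij, if_true] at h1
    rw [sub_eq_iff_eq_add'.1 hXdef, sub_eq_iff_eq_add'.1 hYdef, Matrix.add_mul, Matrix.mul_add,
      Matrix.one_mul, Matrix.mul_one] at h1
    simpa [Matrix.mul_apply] using h1
  have main : ∀ N : ℕ, ∀ i j : Fin n, i.val + (n - j.val) = N → μ i j = μ' i j := by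
    intro N
    induction N using Nat.strong_induction_on with
    | _ N ih =>
      intro i j hN
      by_cases hij : Pm n m i j
      swap
      · rw [hμ i j hij, hμ' i j hij]
      have hprev : ∀ i' j', i' ≤ i → j ≤ j' → (i', j') ≠ (i, j) → μ i' j' = μ' i' j' := by
        intro i' j' h1 h2 h3
        refine ih _ ?_ i' j' rfl
        have h1' : i'.val ≤ i.val := h1
        have h2' : j.val ≤ j'.val := h2
        have h3' : ¬ (i'.val = i.val ∧ j'.val = j.val) := by
          rintro ⟨h4, h5⟩
          exact h3 (Prod.ext (Fin.ext h4) (Fin.ext h5))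
        omega
      have hlhs : ∀ i' j', i' ≤ i → j ≤ j' → ∀ k, X i' k * μ k j' = X i' k * μ' k j' := by
        intro i' j' h1 h2 k
        by_cases hx : X i' k = 0
        · simp [hx]
        · have h3 := (hX _ _ hx).lt
          rw [hprev k j' (h3.le.trans h1) h2]
          intro hc
          exact (h3.trans_le h1).ne (congrArg Prod.fst hc)
      have hrhs : ∀ i' j', i' ≤ i → j ≤ j' → ∀ k, μ' i' k * Y k j' = μ i' k * Y k j' := by
        intro i' j' h1 h2 k
        by_cases hy : Y k j' = 0
        · simp [hy]
        · have h3 := (hY _ _ hy).lt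
          rw [hprev i' k h1 (h2.trans h3.le)]
          intro hc
          exact (h2.trans_lt h3).ne' (congrArg Prod.snd hc)
      by_cases hz : μ i j = 0
      · by_cases hz' : μ' i j = 0
        · rw [hz, hz']
        have hE : ∀ i' j', i' ≤ i → j ≤ j' → Pm n m i' j' →
            μ i' j' + ∑ k, X i' k * μ' k j' = μ' i' j' + ∑ k, μ' i' k * Y k j' := by
          intro i' j' h1 h2 h3
          rw [← hEq i' j' h3]
          simp_rw [hlhs i' j' h1 h2]
        have := h'.sum_eq_sum hμ' hX hY hz' fun i' j' h1 h2 h3 h4 => by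
          have := hE i' j' h1 h2 h4
          rwa [hprev i' j' h1 h2 h3, add_right_inj] at this
        have h5 := hE i j le_rfl le_rfl hij
        rwa [this, add_left_inj] at h5
      · have hE : ∀ i' j', i' ≤ i → j ≤ j' → Pm n m i' j' →
            μ i' j' + ∑ k, X i' k * μ k j' = μ' i' j' + ∑ k, μ i' k * Y k j' := by
          intro i' j' h1 h2 h3
          rw [hEq i' j' h3]
          simp_rw [hrhs i' j' h1 h2]
        have := h.sum_eq_sum hμ hX hY hz fun i' j' h1 h2 h3 h4 => by
          have := hE i' j' h1 h2 h4
          rwa [hprev i' j' h1 h2 h3, add_right_inj] at this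
        have h5 := hE i j le_rfl le_rfl hij
        rwa [this, add_left_inj] at h5
  ext i j
  exact main _ i j rfl

end Forms

section Reduction

variable {n m : ℕ} {F : Type*} [Field F]

/-- Add a multiple of row `p` to row `t` so as to clear the entry in column `c`. -/
lemma exists_row_clear {μ : Mat n F} (hμ : IsFunctional m μ) {p t c : Fin n}
    (hpt : Pm n m p t) (hpc : μ p c ≠ 0) :
    ∃ μ', IsFunctional m μ' ∧ OrbitRel m μ μ' ∧ (∀ i j, i ≠ t → μ' i j = μ i j) ∧
      μ' t c = 0 ∧ ∀ j, μ p j = 0 → μ' t j = μ t j := by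
  set A : Mat n F := 1 + Matrix.single t p (-μ t c / μ p c) with hA
  have hAl : IsLower m A := by
    constructor
    · intro i
      have : ¬ (t = i ∧ p = i) := fun h => hpt.lt.ne (h.2.trans h.1.symm)
      simp [hA, this]
    · intro i j hij hP
      have : ¬ (t = i ∧ p = j) := fun h => hP (h.1 ▸ h.2 ▸ hpt)
      simp [hA, this, hij]
  have hrow : ∀ i j, i ≠ t → (A * μ) i j = μ i j := by
    intro i j hi
    rw [hA, Matrix.add_mul, Matrix.one_mul, Matrix.add_apply,
      Matrix.single_mul_apply_of_ne _ _ _ _ _ hi, add_zero]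
  have hrow_t : ∀ j, (A * μ) t j = μ t j + -μ t c / μ p c * μ p j := by
    intro j
    rw [hA, Matrix.add_mul, Matrix.one_mul, Matrix.add_apply, Matrix.single_mul_apply_same]
  refine ⟨truncP (Pm n m) (A * μ), isFunctional_truncP _, ⟨A, 1, hAl, isLower_one, by simp⟩,
    ?_, ?_, ?_⟩
  · intro i j hi
    conv_rhs => rw [← hμ.truncP_eq]
    simp only [truncP, Matrix.of_apply, hrow i j hi]
  · simp only [truncP, Matrix.of_apply, hrow_t]
    rw [div_mul_cancel₀ _ hpc]
    simp
  · intro j hj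
    conv_rhs => rw [← hμ.truncP_eq]
    simp [truncP, hrow_t, hj]

/-- Clear the entries of row `t` in the columns of `K`, given a triangular system of pivots. -/
lemma exists_row_clear_finset {μ : Mat n F} (hμ : IsFunctional m μ) (t : Fin n)
    (f : Fin n → ℕ) (K : Finset (Fin n))
    (hK : ∀ c ∈ K, ∃ p, Pm n m p t ∧ μ p c ≠ 0 ∧ ∀ c' ∈ K, c' ≠ c → μ p c' ≠ 0 → f c < f c') :
    ∃ μ', IsFunctional m μ' ∧ OrbitRel m μ μ' ∧ (∀ i j, i ≠ t → μ' i j = μ i j) ∧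
      ∀ c ∈ K, μ' t c = 0 := by
  induction K using Finset.induction_on_max_value f with
  | empty => exact ⟨μ, hμ, .refl hμ, fun _ _ _ => rfl, by simp⟩
  | insert a S ha hmax ih =>
    obtain ⟨μ₁, h1, h2, h3, h4⟩ := ih fun c hc => by
      obtain ⟨p, hp, hpc, hp'⟩ := hK c (Finset.mem_insert_of_mem hc)
      exact ⟨p, hp, hpc, fun c' hc' => hp' c' (Finset.mem_insert_of_mem hc')⟩
    obtain ⟨p, hp, hpc, hp'⟩ := hK a (Finset.mem_insert_self _ _)
    have hpt : p ≠ t := hp.lt.ne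
    rw [← h3 p a hpt] at hpc
    obtain ⟨μ₂, g1, g2, g3, g4, g5⟩ := exists_row_clear h1 hp hpc
    refine ⟨μ₂, g1, h2.trans g2, fun i j hi => (g3 i j hi).trans (h3 i j hi), fun c hc => ?_⟩
    rcases Finset.mem_insert.1 hc with rfl | hcS
    · exact g4
    · rw [g5 c, h4 c hcS]
      rw [h3 p c hpt]
      by_contra hne
      exact absurd (hp' c hc (ne_of_mem_of_not_mem hcS ha) hne) (hmax c hcS).not_gt

/-- Clear the entries of row `t` in the columns of `J` by adding multiples of a combination `Z`
of columns that vanishes on the rows above. -/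
lemma exists_col_clear {μ : Mat n F} (hμ : IsFunctional m μ) (t : Fin n) (Z : Fin n → F)
    (J : Finset (Fin n)) (hJ : ∀ k, Z k ≠ 0 → ∀ j ∈ J, Pm n m j k)
    (hZ : ∀ p, p < t → ∀ j ∈ J, Pm n m p j → ∑ k, μ p k * Z k = 0)
    (hZt : ∑ k, μ t k * Z k ≠ 0) :
    ∃ μ', IsFunctional m μ' ∧ OrbitRel m μ μ' ∧ (∀ i j, i < t → μ' i j = μ i j) ∧
      (∀ j ∈ J, μ' t j = 0) ∧ ∀ j, j ∉ J → μ' t j = μ t j := by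
  set y : Fin n → F := fun j => if j ∈ J then -μ t j / ∑ k, μ t k * Z k else 0 with hy
  set B : Mat n F := 1 + Matrix.vecMulVec Z y with hB
  have hBl : IsLower m B := by
    constructor
    · intro i
      have : Z i * y i = 0 := by
        by_contra h
        have h1 : i ∈ J := by
          by_contra h1
          simp [hy, h1] at h
        exact lt_irrefl _ (hJ i (left_ne_zero_of_mul h) i h1).lt
      simp [hB, Matrix.vecMulVec_apply, this]
    · intro i j hij hP
      have : Z i * y j = 0 := by
        by_contra h
        have h1 : j ∈ J := by
          by_contra h1
          simp [hy, h1] at h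
        exact hP (hJ i (left_ne_zero_of_mul h) j h1)
      simp [hB, Matrix.vecMulVec_apply, this, hij]
  have hmul : ∀ i j, (μ * B) i j = μ i j + (∑ k, μ i k * Z k) * y j := by
    intro i j
    rw [hB, Matrix.mul_add, Matrix.mul_one, Matrix.add_apply, Matrix.mul_apply, Finset.sum_mul]
    simp only [Matrix.vecMulVec_apply, mul_assoc]
  refine ⟨truncP (Pm n m) (μ * B), isFunctional_truncP _, ⟨1, B, isLower_one, hBl, by simp⟩,
    ?_, ?_, ?_⟩
  · intro i j hi
    conv_rhs => rw [← hμ.truncP_eq]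
    by_cases hP : Pm n m i j
    · simp only [truncP, Matrix.of_apply, hmul, hP, if_true]
      by_cases hj : j ∈ J
      · rw [hZ i hi j hj hP, zero_mul, add_zero]
      · simp [hy, hj]
    · simp [truncP, hP]
  · intro j hj
    simp only [truncP, Matrix.of_apply, hmul, hy, hj, if_true]
    rw [mul_div_cancel₀ _ hZt]
    simp
  · intro j hj
    conv_rhs => rw [← hμ.truncP_eq]
    simp [truncP, hmul, hy, hj]

/-- Clear the entries of row `t` to the left of a nonzero entry with nothing above it. -/
lemma exists_col_clear_single {μ : Mat n F} (hμ : IsFunctional m μ) {t c : Fin n}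
    (hc : μ t c ≠ 0) (habove : ∀ p, p < t → μ p c = 0) :
    ∃ μ', IsFunctional m μ' ∧ OrbitRel m μ μ' ∧ (∀ i j, i < t → μ' i j = μ i j) ∧
      (∀ j, j < c → μ' t j = 0) ∧ ∀ j, c ≤ j → μ' t j = μ t j := by
  have hmem : ∀ j, j ∈ Finset.univ.filter (fun j => j < c ∧ μ t j ≠ 0) ↔ j < c ∧ μ t j ≠ 0 := by
    simp
  obtain ⟨μ', h1, h2, h3, h4, h5⟩ := exists_col_clear hμ t (Pi.single c 1)
    (Finset.univ.filter fun j => j < c ∧ μ t j ≠ 0) (fun k hk j hj => by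
      obtain rfl : k = c := by
        by_contra h
        simp [h] at hk
      rw [hmem] at hj
      refine ⟨hj.1, fun h0 => ?_⟩
      have : t.val < j.val := (hμ.pm hj.2).lt
      omega)
    (fun p hp j _ _ => by simp [Pi.single_apply, habove p hp])
    (by simpa [Pi.single_apply] using hc)
  refine ⟨μ', h1, h2, h3, fun j hj => ?_, fun j hj => h5 j fun h => ((hmem j).1 h).1.not_ge hj⟩
  by_cases hz : μ t j = 0
  · rw [h5 j fun h => ((hmem j).1 h).2 hz, hz]
  · exact h4 j ((hmem j).2 ⟨hj, hz⟩)

namespace PathForm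

variable {t : Fin n} {r s : ℕ} {μ : Mat n F} {ρ κ : ℕ → Fin n}

/-- Along a path there is a combination of the columns of the path vanishing on all rows but
the first. -/
lemma exists_col_comb (h : PathForm m t μ r s ρ κ) (hs : s = r) (hr : 0 < r) :
    ∃ Z : Fin n → F, Z (κ (r - 1)) ≠ 0 ∧ (∀ k, Z k ≠ 0 → ∃ d, d < r ∧ k = κ d) ∧
      ∀ p : Fin n, p < t → p.val ≠ 0 → ∑ k, μ p k * Z k = 0 := by
  let z : ℕ → F := fun d => d.rec 1
    fun e w => -μ (ρ (e + 1)) (κ e) / μ (ρ (e + 1)) (κ (e + 1)) * w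
  have hz : ∀ e, z (e + 1) = -μ (ρ (e + 1)) (κ e) / μ (ρ (e + 1)) (κ (e + 1)) * z e :=
    fun e => rfl
  have hz0 : ∀ d, d < r → z d ≠ 0 := by
    intro d
    induction d with
    | zero => intro _; exact one_ne_zero
    | succ d ih =>
      intro hd
      rw [hz]
      exact mul_ne_zero (div_ne_zero (neg_ne_zero.2 (h.sub d (by omega))) (h.diag _ hd))
        (ih (by omega))
  refine ⟨fun k => ∑ d ∈ Finset.range r, if κ d = k then z d else 0, ?_, ?_, ?_⟩
  · dsimp only
    rw [Finset.sum_eq_single (r - 1)]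
    · simpa using hz0 (r - 1) (by omega)
    · intro d hd hne
      rw [if_neg]
      intro hc
      exact hne (h.col_inj (Finset.mem_range.1 hd) (by omega) hc)
    · intro hc
      exact absurd (Finset.mem_range.2 (by omega)) hc
  · intro k hk
    obtain ⟨d, hd, hne⟩ := Finset.exists_ne_zero_of_sum_ne_zero hk
    refine ⟨d, Finset.mem_range.1 hd, ?_⟩
    by_contra hc
    exact hne (if_neg fun h' => hc h'.symm)
  · intro p hp hp0
    simp only [Finset.mul_sum]
    rw [Finset.sum_comm]
    simp only [mul_ite, mul_zero, Finset.sum_ite_eq, Finset.mem_univ, if_true]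
    by_cases hex : ∃ e, e + 1 < r ∧ p = ρ (e + 1)
    · obtain ⟨e, he, rfl⟩ := hex
      rw [Finset.sum_eq_add_of_mem e (e + 1) (Finset.mem_range.2 (by omega))
        (Finset.mem_range.2 he) (by omega)]
      · rw [hz]
        have := h.diag (e + 1) he
        field_simp
        ring
      · intro d hd hne
        by_contra hc
        rcases h.row_entry (by omega) (left_ne_zero_of_mul hc) with ⟨-, h1⟩ | ⟨e', h1, h2⟩
        · exact hne.2 (h.col_inj (Finset.mem_range.1 hd) he h1)
        · obtain rfl : e' = e := by omega
          exact hne.1 (h.col_inj (Finset.mem_range.1 hd) (by omega) h2)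
    · refine Finset.sum_eq_zero fun d hd => ?_
      by_contra hc
      rcases h.col_entry (Finset.mem_range.1 hd) hp (left_ne_zero_of_mul hc) with h1 | ⟨h1, h2⟩
      · by_cases hd0 : d = 0
        · subst hd0
          exact hp0 (h1 ▸ h.row_zero hr)
        · have := Finset.mem_range.1 hd
          exact hex ⟨d - 1, by omega, by rw [h1, Nat.sub_add_cancel (by omega)]⟩
      · exact hex ⟨d, by omega, h2⟩

/-- Appending a row without common columns with the path, and with at most one entry. -/
lemma append_isolated (h : PathForm m t μ r s ρ κ)
    (huniq : ∀ j j', μ t j ≠ 0 → μ t j' ≠ 0 → j' = j)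
    (habove : ∀ i j, i < t → μ t j ≠ 0 → μ i j = 0) :
    PathForm m (t.val + 1) μ r s ρ κ where
  length := h.length
  row_zero := h.row_zero
  row_lt d hd := (h.row_lt d hd).trans (Nat.lt_succ_self _)
  row_lt_m := h.row_lt_m
  row_mono := h.row_mono
  col_anti := h.col_anti
  col_ge := h.col_ge
  diag := h.diag
  sub := h.sub
  cover i j hi hij := by
    by_cases hit : i = t
    · subst hit
      refine Or.inr (Or.inr ⟨fun j' hj' => huniq j j' hij hj', fun i' hi' hj' => ?_⟩)
      by_contra hne
      exact hj' (habove i' j (lt_of_le_of_ne (Nat.lt_succ_iff.1 hi') hne) hij)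
    · have hi1 : i.val < t.val := lt_of_le_of_ne (Nat.lt_succ_iff.1 hi) fun hc => hit (Fin.ext hc)
      rcases h.cover i j hi1 hij with h1 | h1 | ⟨h1, h2⟩
      · exact Or.inl h1
      · exact Or.inr (Or.inl h1)
      · refine Or.inr (Or.inr ⟨h1, fun i' hi' hj' => ?_⟩)
        by_cases hit' : i' = t
        · subst hit'
          exact absurd (habove i j hi1 hj') hij
        · exact h2 i' (lt_of_le_of_ne (Nat.lt_succ_iff.1 hi') fun hc => hit' (Fin.ext hc)) hj'

/-- Appending a row that closes the path. -/
lemma append_closed (h : PathForm m t μ r s ρ κ) (hs : s = r) (hr : 0 < r) (htm : t.val < m)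
    (hrow : ∀ j, μ t j ≠ 0 ↔ j = κ (r - 1)) :
    PathForm m (t.val + 1) μ r (r + 1) (fun d => if d < r then ρ d else t) κ := by
  subst hs
  refine ⟨Or.inr ⟨rfl, hr⟩, fun _ => ?_, fun d hd => ?_, fun d hd => ?_, fun d e hde he => ?_,
    h.col_anti, h.col_ge, fun d hd => ?_, fun d hd => ?_, fun i j hi hij => ?_⟩
  · simpa [hr] using h.row_zero hr
  · split_ifs with h1
    · exact (h.row_lt d h1).trans (Nat.lt_succ_self _)
    · exact Nat.lt_succ_self _
  · split_ifs with h1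
    · exact h.row_lt_m d h1
    · exact htm
  · rw [if_pos (by omega)]
    split_ifs with h1
    · exact h.row_mono d e hde h1
    · exact h.row_lt d (by omega)
  · simpa [hd] using h.diag d hd
  · split_ifs with h1
    · exact h.sub d h1
    · rw [hrow]
      congr 1
      omega
  · by_cases hit : i = t
    · subst hit
      refine Or.inr (Or.inl ⟨s - 1, by omega, ?_, (hrow j).1 hij⟩)
      rw [if_neg (by omega)]
    · have hi1 : i.val < t.val := lt_of_le_of_ne (Nat.lt_succ_iff.1 hi) fun hc => hit (Fin.ext hc)
      rcases h.cover i j hi1 hij with ⟨d, hd, h1, h2⟩ | ⟨d, hd, h1, h2⟩ | ⟨h1, h2⟩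
      · exact Or.inl ⟨d, hd, by rw [if_pos hd, h1], h2⟩
      · exact Or.inr (Or.inl ⟨d, by omega, by rw [if_pos hd, h1], h2⟩)
      · by_cases hj : j = κ (s - 1)
        · subst hj
          rcases h.col_entry (by omega) hi1 hij with h3 | ⟨h3, -⟩
          · exact Or.inl ⟨s - 1, by omega, by rw [if_pos (by omega), h3], rfl⟩
          · omega
        · refine Or.inr (Or.inr ⟨h1, fun i' hi' hj' => ?_⟩)
          by_cases hit' : i' = t
          · subst hit'
            exact absurd ((hrow j).1 hj') hj
          · exact h2 i' (lt_of_le_of_ne (Nat.lt_succ_iff.1 hi') fun hc => hit' (Fin.ext hc)) hj'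

/-- Appending a row that extends the path by a new column. -/
lemma append_open (h : PathForm m t μ r s ρ κ) (hs : s = r) (hr : r = 0 → t.val = 0)
    (htm : t.val < m) {c : Fin n} (hmc : m ≤ c.val) (hc : 0 < r → c < κ (r - 1))
    (habove : ∀ i, i < t → μ i c = 0)
    (hrow : ∀ j, μ t j ≠ 0 ↔ j = c ∨ (0 < r ∧ j = κ (r - 1))) :
    PathForm m (t.val + 1) μ (r + 1) (r + 1) (fun d => if d < r then ρ d else t)
      (fun d => if d < r then κ d else c) := by
  subst hs
  refine ⟨Or.inl rfl, fun _ => ?_, fun d hd => ?_, fun d hd => ?_, fun d e hde he => ?_,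
    fun d e hde he => ?_, fun d hd => ?_, fun d hd => ?_, fun d hd => ?_, fun i j hi hij => ?_⟩
  · split_ifs with h1
    · exact h.row_zero h1
    · exact hr (by omega)
  · split_ifs with h1
    · exact (h.row_lt d h1).trans (Nat.lt_succ_self _)
    · exact Nat.lt_succ_self _
  · split_ifs with h1
    · exact h.row_lt_m d h1
    · exact htm
  · rw [if_pos (by omega)]
    split_ifs with h1
    · exact h.row_mono d e hde h1
    · exact h.row_lt d (by omega)
  · rw [if_pos (c := d < s) (by omega)]
    split_ifs with h1
    · exact h.col_anti d e hde h1
    · refine (hc (by omega)).trans_le ?_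
      by_cases hd : d = s - 1
      · rw [hd]
      · exact (h.col_anti d (s - 1) (by omega) (by omega)).le
  · split_ifs with h1
    · exact h.col_ge d h1
    · exact hmc
  · split_ifs with h1
    · exact h.diag d h1
    · exact (hrow c).2 (Or.inl rfl)
  · rw [if_pos (c := d < s) (by omega)]
    split_ifs with h1
    · exact h.sub d h1
    · rw [hrow]
      refine Or.inr ⟨by omega, ?_⟩
      congr 1
      omega
  · by_cases hit : i = t
    · subst hit
      rcases (hrow j).1 hij with rfl | ⟨h1, rfl⟩
      · exact Or.inl ⟨s, by omega, by simp, by simp⟩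
      · refine Or.inr (Or.inl ⟨s - 1, by omega, ?_, ?_⟩)
        · rw [if_neg (by omega)]
        · rw [if_pos (by omega)]
    · have hi1 : i.val < t.val := lt_of_le_of_ne (Nat.lt_succ_iff.1 hi) fun hc => hit (Fin.ext hc)
      rcases h.cover i j hi1 hij with ⟨d, hd, h1, h2⟩ | ⟨d, hd, h1, h2⟩ | ⟨h1, h2⟩
      · exact Or.inl ⟨d, by omega, by rw [if_pos hd, h1], by rw [if_pos hd, h2]⟩
      · exact Or.inr (Or.inl ⟨d, by omega, by rw [if_pos hd, h1], by rw [if_pos (by omega), h2]⟩)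
      · by_cases hj : 0 < s ∧ j = κ (s - 1)
        · obtain ⟨hs, rfl⟩ := hj
          rcases h.col_entry (by omega) hi1 hij with h3 | ⟨h3, -⟩
          · exact Or.inl ⟨s - 1, by omega, by rw [if_pos (by omega), h3], by rw [if_pos (by omega)]⟩
          · omega
        · refine Or.inr (Or.inr ⟨h1, fun i' hi' hj' => ?_⟩)
          by_cases hit' : i' = t
          · subst hit'
            rcases (hrow j).1 hj' with rfl | h3
            · exact absurd (habove i hi1) hij
            · exact absurd h3 hj
          · exact h2 i' (lt_of_le_of_ne (Nat.lt_succ_iff.1 hi') fun hc => hit' (Fin.ext hc)) hj'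

end PathForm

end Reduction

section Existence

variable {n m : ℕ} {F : Type*} [Field F]

lemma Fin.exists_max_of_exists {p : Fin n → Prop} (h : ∃ c, p c) :
    ∃ c, p c ∧ ∀ j, p j → j ≤ c := by
  obtain ⟨c, hc, hmax⟩ := (Set.toFinite {c | p c}).exists_maximal h
  exact ⟨c, hc, fun j hj => (le_total j c).elim id fun h => hmax hj h⟩

/-- `μ` is in path form up to row `t`, and a nonzero first row belongs to the path. -/
def InPathForm (m t : ℕ) (μ : Mat n F) : Prop :=
  ∃ r s ρ κ, PathForm m t μ r s ρ κ ∧ ∀ i j, i.val < t → i.val = 0 → μ i j ≠ 0 → 0 < r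

/-- Clear row `t` in all columns having an entry above, except for the end of an open path. -/
lemma PathForm.exists_row_reduced {t : Fin n} {r s : ℕ} {μ : Mat n F} {ρ κ : ℕ → Fin n}
    (h : PathForm m t μ r s ρ κ) (hμ : IsFunctional m μ)
    (h0 : ∀ i j, i < t → i.val = 0 → μ i j ≠ 0 → 0 < r) :
    ∃ μ', IsFunctional m μ' ∧ OrbitRel m μ μ' ∧ (∀ i j, i ≠ t → μ' i j = μ i j) ∧
      ∀ c, μ' t c ≠ 0 → (∀ p, p < t → μ' p c = 0) ∨
        ((s = r ∧ 0 < r ∧ t.val < m) ∧ c = κ (r - 1)) := by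
  have hrs := h.le_length
  have hsr := h.length_le
  obtain ⟨μ', h1, h2, h3, h4⟩ := exists_row_clear_finset hμ t
    (fun c => if s = r ∧ m ≤ t.val then c.val else n - c.val)
    (Finset.univ.filter fun c => (∃ p, p < t ∧ μ p c ≠ 0) ∧
      ¬ ((s = r ∧ 0 < r ∧ t.val < m) ∧ c = κ (r - 1))) (by
    intro c hc
    simp only [Finset.mem_filter, Finset.mem_univ, true_and] at hc
    obtain ⟨⟨p, hpt, hpc⟩, hopen⟩ := hc
    by_cases hpath : ∃ d, d < r ∧ c = κ d
    · obtain ⟨d, hd, rfl⟩ := hpath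
      by_cases hcase : s = r ∧ m ≤ t.val
      · refine ⟨ρ d, ⟨h.row_lt d (by omega), fun _ => by omega⟩, h.diag d hd, ?_⟩
        intro c' _ hne hc'
        rcases h.row_entry (by omega) hc' with ⟨-, h3⟩ | ⟨e, rfl, rfl⟩
        · exact absurd h3 hne
        · rw [if_pos hcase, if_pos hcase]
          exact h.col_anti _ _ (Nat.lt_succ_self _) hd
      · have hds : d + 1 < s := by
          by_contra hcon
          refine hopen ⟨⟨by omega, by omega, by omega⟩, ?_⟩
          congr 1
          omega
        refine ⟨ρ (d + 1), ⟨h.row_lt _ hds, fun hz => ?_⟩, h.sub d hds, ?_⟩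
        · have : (ρ 0).val < (ρ (d + 1)).val := h.row_mono 0 (d + 1) (by omega) hds
          omega
        · intro c' _ hne hc'
          rcases h.row_entry hds hc' with ⟨h4, rfl⟩ | ⟨e, h4, rfl⟩
          · rw [if_neg hcase, if_neg hcase]
            have : (κ (d + 1)).val < (κ d).val := h.col_anti d (d + 1) (by omega) h4
            omega
          · obtain rfl : d = e := by omega
            exact absurd rfl hne
    · rcases h.cover p c hpt hpc with ⟨d, hd, -, hk⟩ | ⟨d, hd, -, hk⟩ | ⟨h1, -⟩
      · exact absurd ⟨d, hd, hk⟩ hpath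
      · exact absurd ⟨d, by omega, hk⟩ hpath
      · refine ⟨p, ⟨hpt, fun hz => ?_⟩, hpc, fun c' _ hne hc' => absurd (h1 c' hc') hne⟩
        have hr := h0 p c hpt hz hpc
        have hp : p = ρ 0 := Fin.ext (hz.trans (h.row_zero hr).symm)
        subst hp
        exact absurd ⟨0, hr, (h1 _ (h.diag 0 hr)).symm⟩ hpath)
  refine ⟨μ', h1, h2, h3, fun c hc => ?_⟩
  by_contra! hcon
  obtain ⟨⟨p, hpt, hpc⟩, hopen⟩ := hcon
  refine hc (h4 c ?_)
  simp only [Finset.mem_filter, Finset.mem_univ, true_and]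
  rw [h3 _ _ hpt.ne] at hpc
  exact ⟨⟨p, hpt, hpc⟩, fun hc => hopen hc.1 hc.2⟩

/-- Clear the columns below `m` in a row meeting the end of an open path. -/
lemma PathForm.exists_left_cleared {t : Fin n} {r s : ℕ} {μ : Mat n F} {ρ κ : ℕ → Fin n}
    (h : PathForm m t μ r s ρ κ) (hμ : IsFunctional m μ) (hs : s = r) (hr : 0 < r)
    (hend : μ t (κ (r - 1)) ≠ 0) (hmax : ∀ j, μ t j ≠ 0 → j ≤ κ (r - 1)) :
    ∃ μ', IsFunctional m μ' ∧ OrbitRel m μ μ' ∧ (∀ i j, i < t → μ' i j = μ i j) ∧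
      (∀ j : Fin n, j.val < m → μ' t j = 0) ∧ ∀ j : Fin n, m ≤ j.val → μ' t j = μ t j := by
  obtain ⟨Z, hZend, hZsupp, hZ⟩ := h.exists_col_comb hs hr
  have hmem : ∀ j : Fin n, j ∈ Finset.univ.filter (fun j : Fin n => j.val < m ∧ μ t j ≠ 0) ↔
      j.val < m ∧ μ t j ≠ 0 := by simp
  obtain ⟨μ', h1, h2, h3, h4, h5⟩ := exists_col_clear hμ t Z
    (Finset.univ.filter fun j : Fin n => j.val < m ∧ μ t j ≠ 0) (fun k hk j hj => by
      rw [hmem] at hj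
      obtain ⟨d, hd, rfl⟩ := hZsupp k hk
      have h6 := h.col_ge d hd
      have h7 : t.val < j.val := (hμ.pm hj.2).lt
      refine ⟨?_, fun h8 => by omega⟩
      rw [Fin.lt_def]
      omega)
    (fun p hp j hj hpj => hZ p hp fun hp0 => by
      have h6 := hpj.2 hp0
      have h7 := ((hmem j).1 hj).1
      omega)
    (by
      rw [Finset.sum_eq_single (κ (r - 1))]
      · exact mul_ne_zero hend hZend
      · intro k _ hk
        by_contra hne
        obtain ⟨d, hd, rfl⟩ := hZsupp k (right_ne_zero_of_mul hne)
        refine (hmax _ (left_ne_zero_of_mul hne)).not_gt (h.col_anti d (r - 1) ?_ (by omega))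
        have : d ≠ r - 1 := fun hc => hk (hc ▸ rfl)
        omega
      · simp)
  refine ⟨μ', h1, h2, h3, fun j hj => ?_, fun j hj => h5 j fun h => ?_⟩
  · by_cases hz : μ t j = 0
    · rw [h5 j fun h => ((hmem j).1 h).2 hz, hz]
    · exact h4 j ((hmem j).2 ⟨hj, hz⟩)
  · have := ((hmem j).1 h).1
    omega

lemma InPathForm.exists_succ {t : Fin n} {μ : Mat n F} (hm : 0 < m) (h : InPathForm m t μ)
    (hμ : IsFunctional m μ) :
    ∃ μ', IsFunctional m μ' ∧ OrbitRel m μ μ' ∧ InPathForm m (t.val + 1) μ' := by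
  obtain ⟨r, s, ρ, κ, h, h0⟩ := h
  obtain ⟨μ₁, f₁, o₁, e₁, hfree⟩ := h.exists_row_reduced hμ h0
  replace h := h.congr fun i j hi => e₁ i j (ne_of_lt hi)
  replace h0 : ∀ i j, i < t → i.val = 0 → μ₁ i j ≠ 0 → 0 < r := fun i j hi hi0 hij =>
    h0 i j hi hi0 (by rwa [← e₁ i j (ne_of_lt hi)])
  have hpos : ∀ μ' : Mat n F, (∀ i j, i < t → μ' i j = μ₁ i j) → ∀ r', r ≤ r' →
      (t.val = 0 → ∀ j, μ' t j ≠ 0 → 0 < r') →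
      ∀ i j, i.val < t.val + 1 → i.val = 0 → μ' i j ≠ 0 → 0 < r' := by
    intro μ' hμ' r' hr' ht i j hi hi0 hij
    by_cases hit : i = t
    · subst hit
      exact ht hi0 j hij
    · have hi1 : i < t := lt_of_le_of_ne (Nat.lt_succ_iff.1 hi) hit
      exact (h0 i j hi1 hi0 (by rwa [← hμ' i j hi1])).trans_le hr'
  by_cases hrow : ∃ c, μ₁ t c ≠ 0
  swap
  · push Not at hrow
    exact ⟨μ₁, f₁, o₁, r, s, ρ, κ,
      h.append_isolated (fun j _ hj => absurd (hrow j) hj) (fun _ j _ hj => absurd (hrow j) hj),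
      hpos μ₁ (fun _ _ _ => rfl) r le_rfl fun _ j hj => absurd (hrow j) hj⟩
  obtain ⟨c, hc, hmax⟩ := Fin.exists_max_of_exists hrow
  rcases hfree c hc with habove | ⟨⟨hs, hr, htm⟩, rfl⟩
  · obtain ⟨μ₂, f₂, o₂, e₂, hleft, hright⟩ := exists_col_clear_single f₁ hc habove
    have hrow₂ : ∀ j, μ₂ t j ≠ 0 ↔ j = c := by
      intro j
      refine ⟨fun hj => ?_, ?_⟩
      · by_contra hne
        rcases lt_or_gt_of_ne hne with hlt | hlt
        · exact hj (hleft j hlt)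
        · rw [hright j hlt.le] at hj
          exact (hmax j hj).not_gt hlt
      · rintro rfl
        rwa [hright j le_rfl]
    have h₂ := h.congr e₂
    have habove₂ : ∀ i, i < t → μ₂ i c = 0 := fun i hi => (e₂ i c hi).trans (habove i hi)
    by_cases ht : t.val = 0
    · have hs0 : s = 0 := by
        by_contra hs
        have := h.row_lt 0 (by omega)
        omega
      have hr0 : r = 0 := by
        have := h.le_length
        omega
      subst hs0 hr0
      refine ⟨μ₂, f₂, o₁.trans o₂, _, _, _, _, h₂.append_open rfl (fun _ => ht) (by omega)
        (Nat.lt_succ_iff.1 ((f₁.pm hc).2 ht)) (fun h => absurd h (lt_irrefl _)) habove₂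
        (fun j => by simp [hrow₂]), fun _ _ _ _ _ => Nat.succ_pos _⟩
    · refine ⟨μ₂, f₂, o₁.trans o₂, r, s, ρ, κ, h₂.append_isolated (fun j j' hj hj' => ?_)
        (fun i j hi hj => ?_), hpos μ₂ e₂ r le_rfl fun h => absurd h ht⟩
      · rw [(hrow₂ j).1 hj, (hrow₂ j').1 hj']
      · rw [(hrow₂ j).1 hj]
        exact habove₂ i hi
  · obtain ⟨μ₂, f₂, o₂, e₂, hleft, hright⟩ := h.exists_left_cleared f₁ hs hr hc hmax
    have h₂ := h.congr e₂
    have hend : μ₂ t (κ (r - 1)) ≠ 0 := by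
      rwa [hright _ (h.col_ge _ (by omega))]
    have hne₂ : ∀ j, μ₂ t j ≠ 0 → m ≤ j.val ∧ μ₁ t j ≠ 0 := by
      intro j hj
      have hmj : m ≤ j.val := by
        by_contra hlt
        exact hj (hleft j (by omega))
      exact ⟨hmj, by rwa [← hright j hmj]⟩
    by_cases hother : ∃ c, μ₂ t c ≠ 0 ∧ c ≠ κ (r - 1)
    · obtain ⟨c', ⟨hc', hcne⟩, hmax'⟩ := Fin.exists_max_of_exists hother
      obtain ⟨hmc, hc₁⟩ := hne₂ c' hc'
      have hlt : c' < κ (r - 1) := lt_of_le_of_ne (hmax _ hc₁) hcne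
      have habove : ∀ i, i < t → μ₂ i c' = 0 := by
        rcases hfree c' hc₁ with h3 | h3
        · exact fun i hi => (e₂ i c' hi).trans (h3 i hi)
        · exact absurd h3.2 hcne
      obtain ⟨μ₃, f₃, o₃, e₃, hleft', hright'⟩ := exists_col_clear_single f₂ hc' habove
      refine ⟨μ₃, f₃, (o₁.trans o₂).trans o₃, _, _, _, _, (h₂.congr e₃).append_open hs
        (fun h => by omega) htm hmc (fun _ => hlt)
        (fun i hi => (e₃ i c' hi).trans (habove i hi)) (fun j => ⟨fun hj => ?_, ?_⟩),
        fun _ _ _ _ _ => Nat.succ_pos _⟩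
      · by_cases hjc : j < c'
        · exact absurd (hleft' j hjc) hj
        · push Not at hjc
          rw [hright' j hjc] at hj
          by_cases hjk : j = κ (r - 1)
          · exact Or.inr ⟨hr, hjk⟩
          · exact Or.inl (le_antisymm (hmax' j ⟨hj, hjk⟩) hjc)
      · rintro (rfl | ⟨-, rfl⟩)
        · rwa [hright' _ le_rfl]
        · rwa [hright' _ hlt.le]
    · push Not at hother
      refine ⟨μ₂, f₂, o₁.trans o₂, _, _, _, _, h₂.append_closed hs hr htm
        (fun j => ⟨hother j, ?_⟩), fun _ _ _ _ _ => hr⟩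
      rintro rfl
      exact hend

lemma exists_inPathForm (hm : 0 < m) (hn : 0 < n) {μ : Mat n F} (hμ : IsFunctional m μ) :
    ∃ μ', IsFunctional m μ' ∧ OrbitRel m μ μ' ∧ InPathForm m n μ' := by
  suffices h : ∀ t, t ≤ n → ∃ μ', IsFunctional m μ' ∧ OrbitRel m μ μ' ∧ InPathForm m t μ' from
    h n le_rfl
  intro t
  induction t with
  | zero =>
    intro _
    refine ⟨μ, hμ, .refl hμ, 0, 0, fun _ => ⟨0, hn⟩, fun _ => ⟨0, hn⟩,
      ⟨?_, ?_, ?_, ?_, ?_, ?_, ?_, ?_, ?_, ?_⟩, ?_⟩ <;> simp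
  | succ t ih =>
    intro ht
    obtain ⟨μ₁, f₁, o₁, h₁⟩ := ih (by omega)
    obtain ⟨μ₂, f₂, o₂, h₂⟩ := InPathForm.exists_succ (t := ⟨t, ht⟩) hm h₁ f₁
    exact ⟨μ₂, f₂, o₁.trans o₂, h₂⟩

end Existence

section Components

variable {n m : ℕ} {F : Type*} [Field F]

lemma adjRel.symm {A : Mat n F} {p q : Fin n × Fin n} (h : adjRel A p q) : adjRel A q p :=
  ⟨h.1.symm, h.2.2.1, h.2.1, h.2.2.2.imp Eq.symm Eq.symm⟩

lemma mem_compOf_self (A : Mat n F) (p : Fin n × Fin n) : p ∈ compOf A p :=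
  Relation.ReflTransGen.refl

lemma mem_compOf_symm {A : Mat n F} {p q : Fin n × Fin n} (h : q ∈ compOf A p) :
    p ∈ compOf A q :=
  haveI : Std.Symm (adjRel A) := ⟨fun _ _ h => h.symm⟩
  Std.Symm.symm (r := Relation.ReflTransGen (adjRel A)) p q h

lemma compOf_eq_of_mem {A : Mat n F} {p q : Fin n × Fin n} (h : q ∈ compOf A p) :
    compOf A q = compOf A p :=
  Set.ext fun _ => ⟨fun h' => Relation.ReflTransGen.trans h h',
    fun h' => Relation.ReflTransGen.trans (mem_compOf_symm h) h'⟩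

lemma ne_zero_of_mem_compOf {A : Mat n F} {p q : Fin n × Fin n} (hp : A p.1 p.2 ≠ 0)
    (h : q ∈ compOf A p) : A q.1 q.2 ≠ 0 := by
  rcases Relation.ReflTransGen.cases_tail h with rfl | ⟨_, -, h⟩
  · exact hp
  · exact h.2.2.1

lemma adjRel.one_lt_ncard {A : Mat n F} {p q : Fin n × Fin n} (h : adjRel A p q) :
    1 < (compOf A p).ncard :=
  (Set.one_lt_ncard (Set.toFinite _)).2 ⟨p, mem_compOf_self A p, q, .single h, h.1⟩

/-- An entry whose component is a single vertex shares its row and column with no other entry. -/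
lemma isolated_of_not_one_lt_ncard {A : Mat n F} {i j : Fin n} (hij : A i j ≠ 0)
    (h : ¬ 1 < (compOf A (i, j)).ncard) :
    (∀ j', A i j' ≠ 0 → j' = j) ∧ ∀ i', A i' j ≠ 0 → i' = i := by
  refine ⟨fun j' hj' => ?_, fun i' hi' => ?_⟩ <;> by_contra hne <;> refine h ?_
  · exact adjRel.one_lt_ncard (q := (i, j'))
      ⟨fun hc => hne (congrArg Prod.snd hc).symm, hij, hj', Or.inl rfl⟩
  · exact adjRel.one_lt_ncard (q := (i', j))
      ⟨fun hc => hne (congrArg Prod.fst hc).symm, hij, hi', Or.inr rfl⟩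

namespace PathForm

variable {r s : ℕ} {μ : Mat n F} {ρ κ : ℕ → Fin n}

lemma compOf_eq_singleton {i j : Fin n}
    (h : (∀ j', μ i j' ≠ 0 → j' = j) ∧ ∀ i', μ i' j ≠ 0 → i' = i) :
    compOf μ (i, j) = {(i, j)} := by
  ext q
  refine ⟨fun hq => ?_, fun hq => hq ▸ mem_compOf_self _ _⟩
  rcases Relation.ReflTransGen.cases_head hq with hq | ⟨⟨i', j'⟩, hadj, -⟩
  · exact hq.symm
  · obtain ⟨hne, -, hz, h1 | h1⟩ := hadj <;> dsimp only at h1 hz <;> subst h1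
    · exact absurd (by rw [h.1 _ hz]) hne
    · exact absurd (by rw [h.2 _ hz]) hne

/-- The vertices of the path. -/
def vertices (r s : ℕ) (ρ κ : ℕ → Fin n) : Set (Fin n × Fin n) :=
  {v | (∃ d, d < r ∧ v.1 = ρ d ∧ v.2 = κ d) ∨ ∃ d, d + 1 < s ∧ v.1 = ρ (d + 1) ∧ v.2 = κ d}

lemma compOf_eq_vertices (h : PathForm m n μ r s ρ κ) (hr : 0 < r) :
    compOf μ (ρ 0, κ 0) = vertices r s ρ κ := by
  have hsr := h.length_le
  ext q
  constructor
  · intro hq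
    induction hq with
    | refl => exact Or.inl ⟨0, hr, rfl, rfl⟩
    | @tail v w _ hvw hv =>
      obtain ⟨hne, hv0, hw0, hsh⟩ := hvw
      rcases h.cover w.1 w.2 w.1.2 hw0 with h1 | h1 | ⟨h1, h2⟩
      · exact Or.inl h1
      · exact Or.inr h1
      · rcases hsh with hsh | hsh
        · exact absurd (Prod.ext hsh (h1 _ (hsh ▸ hv0))) hne
        · exact absurd (Prod.ext (h2 _ v.1.2 (hsh ▸ hv0)) hsh) hne
  · have hsub : ∀ d, d + 1 < s → (ρ d, κ d) ∈ compOf μ (ρ 0, κ 0) →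
        (ρ (d + 1), κ d) ∈ compOf μ (ρ 0, κ 0) := by
      intro d hd hmem
      refine Relation.ReflTransGen.tail hmem
        ⟨fun hc => ?_, h.diag d (by omega), h.sub d hd, Or.inr rfl⟩
      exact (h.row_mono d (d + 1) (Nat.lt_succ_self d) hd).ne (congrArg Prod.fst hc)
    have hdiag : ∀ d, d < r → (ρ d, κ d) ∈ compOf μ (ρ 0, κ 0) := by
      intro d
      induction d with
      | zero => exact fun _ => mem_compOf_self _ _
      | succ d ih =>
        intro hd
        have hds := hd.trans_le h.le_length
        refine Relation.ReflTransGen.tail (hsub d hds (ih (by omega)))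
          ⟨fun hc => ?_, h.sub d hds, h.diag _ hd, Or.inl rfl⟩
        exact (h.col_anti d (d + 1) (Nat.lt_succ_self d) hd).ne' (congrArg Prod.snd hc)
    obtain ⟨i, j⟩ := q
    rintro (⟨d, hd, h1, h2⟩ | ⟨d, hd, h1, h2⟩) <;> dsimp only at h1 h2 <;> subst h1 h2
    · exact hdiag d hd
    · exact hsub d hd (hdiag d (by omega))

lemma pathCharComp_vertices (h : PathForm m n μ r s ρ κ) (hr : 0 < r) :
    PathCharComp m (vertices r s ρ κ) := by
  have hrs := h.le_length
  have hsr := h.length_le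
  have hr' : (if decide (s = r + 1) = true then r else r - 1) = s - 1 := by
    simp only [decide_eq_true_eq]
    split_ifs <;> omega
  refine ⟨r, decide (s = r + 1), fun d => if d < s then (ρ d).val + 1 else 2,
    fun d => (κ (d - 1)).val + 1, hr, fun d h1 hd => ?_, ?_, ?_, ?_, ?_, ?_, ?_⟩
  · have : (κ (d + 1 - 1)).val < (κ (d - 1)).val := h.col_anti _ _ (by omega) (by omega)
    dsimp only
    omega
  · exact Nat.lt_succ_of_le (h.col_ge _ (by omega))
  · exact (κ _).2
  · rw [hr']
    intro d h1 hd
    dsimp only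
    rw [if_pos (by omega), if_pos (by omega)]
    exact Nat.succ_lt_succ (h.row_mono d (d + 1) (Nat.lt_succ_self d) (by omega))
  · rw [hr']
    dsimp only
    rw [if_pos (by omega)]
    exact h.row_lt_m _ (by omega)
  · dsimp only
    split_ifs with h1
    · have : (ρ 0).val < (ρ 1).val := h.row_mono 0 1 one_pos h1
      omega
    · exact one_lt_two
  · ext ⟨i, j⟩
    have h0 := h.row_zero hr
    simp only [vertices, Set.mem_ofPred_eq, Fin.ext_iff, decide_eq_true_eq]
    constructor
    · rintro (⟨d, hd, h1, h2⟩ | ⟨d, hd, h1, h2⟩)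
      · rcases Nat.eq_zero_or_pos d with rfl | hd0
        · exact Or.inl ⟨by omega, by simpa using h2⟩
        · exact Or.inr (Or.inr (Or.inl ⟨d, hd0, by omega, by rw [if_pos (by omega), h1],
            by rw [h2, Nat.add_sub_cancel]⟩))
      · by_cases hdr : d + 1 < r
        · exact Or.inr (Or.inl ⟨d + 1, by omega, by omega, by rw [if_pos hd, h1],
            by rw [h2, Nat.add_sub_cancel]⟩)
        · obtain rfl : r = d + 1 := by omega
          exact Or.inr (Or.inr (Or.inr ⟨by omega, by rw [if_pos hd, h1],
            by rw [h2, Nat.add_sub_cancel]⟩))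
    · rintro (⟨h1, h2⟩ | ⟨d, h1, hd, h2, h3⟩ | ⟨d, h1, hd, h2, h3⟩ | ⟨hs, h2, h3⟩)
      · exact Or.inl ⟨0, hr, by omega, by simpa using h2⟩
      · rw [if_pos (by omega)] at h2
        refine Or.inr ⟨d - 1, by omega, ?_, by omega⟩
        rw [Nat.sub_add_cancel h1]
        omega
      · rw [if_pos (by omega)] at h2
        rw [Nat.add_sub_cancel] at h3
        exact Or.inl ⟨d, by omega, by omega, by omega⟩
      · rw [if_pos (by omega)] at h2
        refine Or.inr ⟨r - 1, by omega, ?_, by omega⟩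
        rw [Nat.sub_add_cancel hr]
        omega

lemma isPathCharRep (h : PathForm m n μ r s ρ κ) : IsPathCharRep m μ := by
  have key : ∀ p : Fin n × Fin n, μ p.1 p.2 ≠ 0 → 1 < (compOf μ p).ncard →
      0 < r ∧ compOf μ p = vertices r s ρ κ := by
    intro p hp hbig
    have hsr := h.length_le
    have hsr' := h.length
    have hv : p ∈ vertices r s ρ κ := by
      rcases h.cover p.1 p.2 p.1.2 hp with h1 | h1 | ⟨h1, h2⟩
      · exact Or.inl h1
      · exact Or.inr h1
      · rw [compOf_eq_singleton (i := p.1) (j := p.2) ⟨h1, fun i' => h2 i' i'.2⟩] at hbig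
        simp at hbig
    have hr : 0 < r := by
      rcases hv with ⟨d, hd, -⟩ | ⟨d, hd, -⟩ <;> omega
    rw [← h.compOf_eq_vertices hr] at hv ⊢
    exact ⟨hr, compOf_eq_of_mem hv⟩
  refine ⟨fun p q hp hq hp' hq' => ?_, fun p hp hp' => ?_⟩
  · rw [(key p hp hp').2, (key q hq hq').2]
  · obtain ⟨hr, hc⟩ := key p hp hp'
    rw [hc]
    exact h.pathCharComp_vertices hr

end PathForm

lemma IsPathCharRep.exists_pathForm {μ : Mat n F} (hm : 0 < m) (hn : 0 < n) (hmn : m ≤ n)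
    (h : IsPathCharRep m μ) :
    ∃ r s ρ κ, PathForm m n μ r s ρ κ := by
  obtain ⟨hone, hcomp⟩ := h
  by_cases hbig : ∃ p : Fin n × Fin n, μ p.1 p.2 ≠ 0 ∧ 1 < (compOf μ p).ncard
  swap
  · push Not at hbig
    refine ⟨0, 0, fun _ => ⟨0, hn⟩, fun _ => ⟨0, hn⟩, Or.inl rfl, ?_, ?_, ?_, ?_, ?_, ?_, ?_, ?_,
      fun i j _ hij => Or.inr (Or.inr ?_)⟩
    any_goals simp
    have := isolated_of_not_one_lt_ncard hij (hbig (i, j) hij).not_gt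
    exact ⟨this.1, fun i' => this.2 i'⟩
  obtain ⟨p, hp, hpbig⟩ := hbig
  obtain ⟨r, e, i, k, hr, hk, hkr, hk1, hi, hir, hi1, hS⟩ := hcomp p hp hpbig
  set s := if e then r + 1 else r with hs
  have hs1 : (if e = true then r else r - 1) = s - 1 := by
    rw [hs]
    split_ifs <;> omega
  rw [hs1] at hi hir
  have hsr : s = r ∨ s = r + 1 := by
    rw [hs]
    split_ifs <;> simp
  have he : e = true ↔ s = r + 1 := by
    rw [hs]
    split_ifs with h1 <;> simp [h1]
  have himono : ∀ d e, 1 ≤ d → d < e → e < s → i d < i e := by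
    intro d e hd hde hes
    induction e, hde using Nat.le_induction with
    | base => exact hi d hd (by omega)
    | succ e hde ih => exact (ih (by omega)).trans (hi e (by omega) (by omega))
  have hkanti : ∀ d e, 1 ≤ d → d < e → e ≤ r → k e < k d := by
    intro d e hd hde hes
    induction e, hde using Nat.le_induction with
    | base => exact hk d hd (by omega)
    | succ e hde ih => exact (hk e (by omega) (by omega)).trans (ih (by omega))
  have hi_le : ∀ d, 1 ≤ d → d < s → i d ≤ m := by
    intro d hd hds
    by_cases hd1 : d = s - 1
    · rwa [hd1]
    · exact (himono d (s - 1) hd (by omega) (by omega)).le.trans hir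
  have hi_ge : ∀ d, 1 ≤ d → d < s → 1 < i d := by
    intro d hd hds
    by_cases hd1 : d = 1
    · rwa [hd1]
    · exact hi1.trans (himono 1 d le_rfl (by omega) hds)
  have hk_le : ∀ d, 1 ≤ d → d ≤ r → k d ≤ n := by
    intro d hd hds
    by_cases hd1 : d = 1
    · rwa [hd1]
    · exact (hkanti 1 d le_rfl (by omega) hds).le.trans hk1
  have hk_ge : ∀ d, 1 ≤ d → d ≤ r → m < k d := by
    intro d hd hds
    by_cases hd1 : d = r
    · rwa [hd1]
    · exact hkr.trans (hkanti d r hd (by omega) le_rfl)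
  let ρ : ℕ → Fin n := fun d => if h : 1 ≤ d ∧ d < s then ⟨i d - 1, by
    have := hi_le d h.1 h.2
    omega⟩ else ⟨0, hn⟩
  let κ : ℕ → Fin n := fun d => if h : d < r then ⟨k (d + 1) - 1, by
    have := hk_le (d + 1) (by omega) (by omega)
    omega⟩ else ⟨0, hn⟩
  have hρ0 : (ρ 0).val = 0 := by simp [ρ]
  have hρ : ∀ d, 1 ≤ d → d < s → (ρ d).val + 1 = i d := by
    intro d h1 h2
    have := hi_ge d h1 h2
    simp only [ρ, dif_pos (And.intro h1 h2)]
    omega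
  have hκ : ∀ d, d < r → (κ d).val + 1 = k (d + 1) := by
    intro d h1
    have := hk_ge (d + 1) (by omega) (by omega)
    simp only [κ, dif_pos h1]
    omega
  have hV : compOf μ p = PathForm.vertices r s ρ κ := by
    rw [hS]
    ext ⟨a, b⟩
    simp only [PathForm.vertices, Set.mem_ofPred_eq, Fin.ext_iff]
    constructor
    · rintro (⟨h1, h2⟩ | ⟨d, h1, hd, h2, h3⟩ | ⟨d, h1, hd, h2, h3⟩ | ⟨hs, h2, h3⟩)
      · refine Or.inl ⟨0, hr, by omega, ?_⟩
        have := hκ 0 hr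
        rw [zero_add] at this
        omega
      · refine Or.inr ⟨d - 1, by omega, ?_, ?_⟩
        · have := hρ d h1 (by omega)
          rw [Nat.sub_add_cancel h1]
          omega
        · have := hκ (d - 1) (by omega)
          rw [Nat.sub_add_cancel h1] at this
          omega
      · have h4 := hρ d h1 (by omega)
        have h5 := hκ d (by omega)
        exact Or.inl ⟨d, by omega, by omega, by omega⟩
      · rw [he] at hs
        refine Or.inr ⟨r - 1, by omega, ?_, ?_⟩
        · have := hρ r hr (by omega)
          rw [Nat.sub_add_cancel hr]
          omega
        · have := hκ (r - 1) (by omega)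
          rw [Nat.sub_add_cancel hr] at this
          omega
    · rintro (⟨d, hd, h1, h2⟩ | ⟨d, hd, h1, h2⟩)
      · have h5 := hκ d hd
        rcases Nat.eq_zero_or_pos d with rfl | hd0
        · refine Or.inl ⟨by omega, ?_⟩
          rw [zero_add] at h5
          omega
        · have h4 := hρ d hd0 (by omega)
          exact Or.inr (Or.inr (Or.inl ⟨d, hd0, by omega, by omega, by omega⟩))
      · have h4 := hρ (d + 1) (by omega) hd
        have h5 := hκ d (by omega)
        by_cases hdr : d + 1 < r
        · exact Or.inr (Or.inl ⟨d + 1, by omega, by omega, by omega, by omega⟩)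
        · obtain rfl : r = d + 1 := by omega
          exact Or.inr (Or.inr (Or.inr ⟨he.2 (by omega), by omega, by omega⟩))
  have hne : ∀ v, v ∈ PathForm.vertices r s ρ κ → μ v.1 v.2 ≠ 0 := fun v hv =>
    ne_zero_of_mem_compOf hp (hV ▸ hv)
  refine ⟨r, s, ρ, κ, ?_, fun _ => hρ0, fun d _ => (ρ d).2, fun d hd => ?_, fun d e hde hes => ?_,
    fun d e hde hes => ?_, fun d hd => ?_, fun d hd => ?_, fun d hd => ?_, fun a b _ hab => ?_⟩
  · exact hsr.imp id fun h => ⟨h, hr⟩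
  · rcases Nat.eq_zero_or_pos d with rfl | hd0
    · omega
    · have := hρ d hd0 hd
      have := hi_le d hd0 hd
      omega
  · rw [Fin.lt_def]
    have h2 := hρ e (by omega) hes
    rcases Nat.eq_zero_or_pos d with rfl | hd0
    · have := hi_ge e (by omega) hes
      omega
    · have := hρ d hd0 (by omega)
      have := himono d e hd0 hde hes
      omega
  · rw [Fin.lt_def]
    have h1 := hκ d (by omega)
    have h2 := hκ e hes
    have := hkanti (d + 1) (e + 1) (by omega) (by omega) (by omega)
    omega
  · have h1 := hκ d hd
    have := hk_ge (d + 1) (by omega) (by omega)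
    omega
  · exact hne (ρ d, κ d) (Or.inl ⟨d, hd, rfl, rfl⟩)
  · exact hne (ρ (d + 1), κ d) (Or.inr ⟨d, hd, rfl, rfl⟩)
  · by_cases hbig : 1 < (compOf μ (a, b)).ncard
    · have hv : (a, b) ∈ PathForm.vertices r s ρ κ := by
        rw [← hV, ← hone (a, b) p hab hp hbig hpbig]
        exact mem_compOf_self _ _
      rcases hv with h1 | h1
      · exact Or.inl h1
      · exact Or.inr (Or.inl h1)
    · have := isolated_of_not_one_lt_ncard hab hbig
      exact Or.inr (Or.inr ⟨this.1, fun i' _ => this.2 i'⟩)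

end Components

/-- For `0 < m < n`, every two-sided orbit of `U_(m)` on `𝔫_(m)^*` contains
exactly one path supercharacter representative. -/
theorem stmt9 {n m : ℕ} (hm : 0 < m) (hmn : m < n) {F : Type*} [Field F] [Fintype F]
    (lam : Mat n F) (hlam : ∀ i j : Fin n, ¬ Pm n m i j → lam i j = 0) :
    ∃! mu : Mat n F, (∀ i j : Fin n, ¬ Pm n m i j → mu i j = 0) ∧
      IsPathCharRep m mu ∧ mu ∈ dualOrbit (Pm n m) lam := by
  have hn : 0 < n := hm.trans hmn
  obtain ⟨mu, hmu, hrel, r, s, ρ, κ, hform, -⟩ := exists_inPathForm hm hn (μ := lam) hlam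
  refine ⟨mu, ⟨hmu, hform.isPathCharRep, mem_dualOrbit_iff.2 hrel⟩, ?_⟩
  rintro nu ⟨hnu, hrep, horb⟩
  obtain ⟨r', s', ρ', κ', hform'⟩ := hrep.exists_pathForm hm hn hmn.le
  exact hform'.eq_of_orbitRel hform hnu hmu
    (((mem_dualOrbit_iff.1 horb).symm hlam).trans hrel)
end

section
/- Let U_P be a pattern group and let λ, μ, ν ∈ 𝔫_P* satisfy λ = μ + ν, where no row index carries nonzero entries of both μ and ν and no column index carries nonzero entries of both μ and ν. Then χ^λ(u) = χ^μ(u) · χ^ν(u) for all u ∈ U_P. -/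
open Matrix BigOperators
open scoped Classical

section Helpers

/-- A map from a finite group whose fibres are translates of one another is equidistributed on
its image. -/
lemma sum_comp_mul_card_image {H X : Type*} [Group H] [Fintype H] [DecidableEq X] (φ : H → X)
    (hφ : ∀ k g h, φ g = φ h → φ (k * g) = φ (k * h)) (f : X → ℂ) :
    (∑ h, f (φ h)) * ((Finset.univ.image φ).card : ℂ) =
      (Fintype.card H : ℂ) * ∑ y ∈ Finset.univ.image φ, f y := by
  have hfib : ∀ y ∈ Finset.univ.image φ,
      (Finset.univ.filter fun h => φ h = y).card =
        (Finset.univ.filter fun h => φ h = φ 1).card := by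
    intro y hy
    obtain ⟨g, -, rfl⟩ := Finset.mem_image.1 hy
    refine Finset.card_bij' (fun h _ => g⁻¹ * h) (fun h _ => g * h) ?_ ?_ ?_ ?_
    · intro h hh
      have := hφ g⁻¹ _ _ (Finset.mem_filter.1 hh).2
      simpa using this
    · intro h hh
      have := hφ g _ _ (Finset.mem_filter.1 hh).2
      simpa using this
    · simp
    · simp
  have hcard : Fintype.card H =
      (Finset.univ.image φ).card * (Finset.univ.filter fun h => φ h = φ 1).card := by
    rw [← Finset.card_univ,
      Finset.card_eq_sum_card_fiberwise (f := φ) (t := Finset.univ.image φ) (by intro x; simp),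
      Finset.sum_congr rfl hfib, Finset.sum_const, smul_eq_mul]
  rw [Finset.sum_comp f φ, Finset.sum_congr rfl fun y hy => by rw [hfib y hy], ← Finset.smul_sum,
    hcard]
  push_cast
  simp only [nsmul_eq_mul]
  ring

/-- If `F` and `G` depend on complementary parts of their argument, with `mix` exchanging these
parts, then they are independent for the uniform distribution. -/
lemma card_mul_sum_mul_of_mix {α : Type*} [Fintype α] (mix : α → α → α)
    (hmix : ∀ a b, mix (mix a b) (mix b a) = a) (F G : α → ℂ)
    (hF : ∀ a b, F (mix a b) = F a) (hG : ∀ a b, G (mix a b) = G b) :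
    (Fintype.card α : ℂ) * ∑ a, F a * G a = (∑ a, F a) * ∑ a, G a := by
  let e : α × α ≃ α × α :=
    { toFun := fun p => (mix p.1 p.2, mix p.2 p.1)
      invFun := fun p => (mix p.1 p.2, mix p.2 p.1)
      left_inv := fun p => by simp [hmix]
      right_inv := fun p => by simp [hmix] }
  calc (Fintype.card α : ℂ) * ∑ a, F a * G a = ∑ p : α × α, F p.1 * G p.1 := by
        simp [Fintype.sum_prod_type, Finset.mul_sum]
    _ = ∑ p : α × α, F (e p).1 * G (e p).1 := (Equiv.sum_comp e fun p => F p.1 * G p.1).symm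
    _ = ∑ p : α × α, F p.1 * G p.2 := by simp [e, hF, hG]
    _ = _ := by rw [Fintype.sum_prod_type, Finset.sum_mul_sum]

variable {n : ℕ} {F : Type*} [Field F] {P : Fin n → Fin n → Prop}

lemma one_mem_patGroup : (1 : Mat n F) ∈ (patGroup P : Set (Mat n F)) :=
  ⟨fun i => Matrix.one_apply_eq i, fun _ _ h _ => Matrix.one_apply_ne h⟩

lemma eq_or_of_mem_patGroup {a : Mat n F} (ha : a ∈ (patGroup P : Set (Mat n F))) {i j : Fin n}
    (h : a i j ≠ 0) : i = j ∨ P i j := by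
  by_contra! hc
  exact h (ha.2 i j hc.1 hc.2)

lemma mul_mem_patGroup (hP1 : ∀ i j : Fin n, P i j → i < j)
    (hP2 : ∀ i j k : Fin n, P i j → P j k → P i k) {a b : Mat n F}
    (ha : a ∈ (patGroup P : Set (Mat n F))) (hb : b ∈ (patGroup P : Set (Mat n F))) :
    a * b ∈ (patGroup P : Set (Mat n F)) := by
  refine ⟨fun i => ?_, fun i j hij hPij => ?_⟩
  · rw [Matrix.mul_apply, Finset.sum_eq_single i, ha.1, hb.1, one_mul]
    · intro k _ hk
      by_contra hne
      rcases eq_or_of_mem_patGroup ha (left_ne_zero_of_mul hne) with h | h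
      · exact hk h.symm
      rcases eq_or_of_mem_patGroup hb (right_ne_zero_of_mul hne) with h' | h'
      · exact hk h'
      exact lt_asymm (hP1 _ _ h) (hP1 _ _ h')
    · simp
  · rw [Matrix.mul_apply]
    refine Finset.sum_eq_zero fun k _ => ?_
    by_contra hne
    rcases eq_or_of_mem_patGroup ha (left_ne_zero_of_mul hne) with rfl | h <;>
      rcases eq_or_of_mem_patGroup hb (right_ne_zero_of_mul hne) with rfl | h'
    · exact hij rfl
    · exact hPij h'
    · exact hPij h
    · exact hPij (hP2 _ _ _ h h')

lemma det_eq_one_of_mem_patGroup (hP1 : ∀ i j : Fin n, P i j → i < j) {a : Mat n F}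
    (ha : a ∈ (patGroup P : Set (Mat n F))) : a.det = 1 := by
  rw [Matrix.det_of_isUpperTriangular, Finset.prod_eq_one fun i _ => ha.1 i]
  intro i j hij
  by_contra hne
  rcases eq_or_of_mem_patGroup ha hne with h | h
  · exact hij.ne h.symm
  · exact lt_asymm hij (hP1 _ _ h)

lemma inv_mem_patGroup [Fintype F] (hP1 : ∀ i j : Fin n, P i j → i < j)
    (hP2 : ∀ i j k : Fin n, P i j → P j k → P i k) {a : Mat n F}
    (ha : a ∈ (patGroup P : Set (Mat n F))) : a⁻¹ ∈ (patGroup P : Set (Mat n F)) := by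
  have hdet : IsUnit a.det := by simp [det_eq_one_of_mem_patGroup hP1 ha]
  let m : ↥(patGroup P : Set (Mat n F)) → ↥(patGroup P : Set (Mat n F)) :=
    fun b => ⟨a * b.1, mul_mem_patGroup hP1 hP2 ha b.2⟩
  have hm : Function.Injective m := fun b c hbc => by
    have h : a * (b : Mat n F) = a * c := congrArg Subtype.val hbc
    have := congrArg (a⁻¹ * ·) h
    simpa [Matrix.nonsing_inv_mul_cancel_left _ _ hdet, Subtype.ext_iff] using this
  obtain ⟨b, hb⟩ := (Finite.surjective_of_injective hm) ⟨1, one_mem_patGroup⟩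
  have hab : a * (b : Mat n F) = 1 := congrArg Subtype.val hb
  rw [Matrix.inv_eq_right_inv hab]
  exact b.2

/-- The group structure on a pattern group, with the matrix product and inverse. -/
noncomputable abbrev patGroupGroup [Fintype F] (hP1 : ∀ i j : Fin n, P i j → i < j)
    (hP2 : ∀ i j k : Fin n, P i j → P j k → P i k) : Group (patGroup P : Set (Mat n F)) :=
  letI : Mul (patGroup P : Set (Mat n F)) := ⟨fun a b => ⟨a * b, mul_mem_patGroup hP1 hP2 a.2 b.2⟩⟩
  letI : One (patGroup P : Set (Mat n F)) := ⟨⟨1, one_mem_patGroup⟩⟩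
  letI : Inv (patGroup P : Set (Mat n F)) := ⟨fun a => ⟨(a : Mat n F)⁻¹, inv_mem_patGroup hP1 hP2 a.2⟩⟩
  Group.ofLeftAxioms (fun a b c => Subtype.ext (mul_assoc (a : Mat n F) b c))
    (fun a => Subtype.ext (one_mul (a : Mat n F)))
    (fun a => Subtype.ext (Matrix.nonsing_inv_mul (a : Mat n F)
      (by simp [det_eq_one_of_mem_patGroup hP1 a.2])))

/-- Truncation is compatible with the two-sided action of the pattern group. -/
lemma truncP_mul_mul_congr (hP2 : ∀ i j k : Fin n, P i j → P j k → P i k) {a b M N : Mat n F}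
    (ha : a ∈ (patGroup P : Set (Mat n F))) (hb : b ∈ (patGroup P : Set (Mat n F)))
    (h : truncP P M = truncP P N) :
    truncP P (aᵀ * M * bᵀ) = truncP P (aᵀ * N * bᵀ) := by
  ext i j
  simp only [truncP, Matrix.of_apply]
  split_ifs with hij
  · simp only [Matrix.mul_apply, Matrix.transpose_apply]
    refine Finset.sum_congr rfl fun q _ => ?_
    by_cases hq : b j q = 0
    · simp [hq]
    congr 1
    refine Finset.sum_congr rfl fun p _ => ?_
    by_cases hp : a p i = 0
    · simp [hp]
    have hiq : P i q := by
      rcases eq_or_of_mem_patGroup hb hq with rfl | h'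
      exacts [hij, hP2 _ _ _ hij h']
    have hpq : P p q := by
      rcases eq_or_of_mem_patGroup ha hp with rfl | h'
      exacts [hiq, hP2 _ _ _ h' hiq]
    have := congrFun (congrFun h p) q
    simp only [truncP, Matrix.of_apply, if_pos hpq] at this
    rw [this]
  · rfl

lemma pairM_truncP {M x : Mat n F} (hx : ∀ i j, ¬ P i j → x i j = 0) :
    pairM (truncP P M) x = pairM M x := by
  refine Finset.sum_congr rfl fun i _ => Finset.sum_congr rfl fun j _ => ?_
  by_cases hij : P i j <;> simp [truncP, hij, hx]

lemma pairM_eq_trace (A B : Mat n F) : pairM A B = Matrix.trace (A * Bᵀ) := by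
  simp [pairM, Matrix.trace, Matrix.mul_apply]

lemma pairM_transpose_mul_mul (a b M x : Mat n F) :
    pairM (aᵀ * M * bᵀ) x = pairM M (a * x * b) := by
  rw [pairM_eq_trace, pairM_eq_trace, Matrix.transpose_mul, Matrix.transpose_mul,
    Matrix.mul_assoc, Matrix.mul_assoc, Matrix.trace_mul_comm]
  simp only [Matrix.mul_assoc]

lemma pairM_add_left (A B x : Mat n F) : pairM (A + B) x = pairM A x + pairM B x := by
  simp [pairM, add_mul, Finset.sum_add_distrib]

lemma pairM_congr {A x y : Mat n F} (h : ∀ i j, A i j ≠ 0 → x i j = y i j) :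
    pairM A x = pairM A y := by
  refine Finset.sum_congr rfl fun i _ => Finset.sum_congr rfl fun j _ => ?_
  by_cases hA : A i j = 0
  · simp [hA]
  · rw [h i j hA]

/-- The element of the pattern group agreeing with `a` on the positions satisfying `I` and with
`b` elsewhere. -/
noncomputable def mixPat (I : Fin n → Fin n → Prop) (a b : (patGroup P : Set (Mat n F))) :
    (patGroup P : Set (Mat n F)) :=
  ⟨Matrix.of fun i j => if I i j then a.1 i j else b.1 i j, by
    refine ⟨fun i => ?_, fun i j h h' => ?_⟩
    · simp [a.2.1 i, b.2.1 i]
    · simp [a.2.2 i j h h', b.2.2 i j h h']⟩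

lemma mixPat_apply (I : Fin n → Fin n → Prop) (a b : (patGroup P : Set (Mat n F)))
    (i j : Fin n) : (mixPat I a b).1 i j = if I i j then a.1 i j else b.1 i j := rfl

lemma mixPat_mixPat (I : Fin n → Fin n → Prop) (a b : (patGroup P : Set (Mat n F))) :
    mixPat I (mixPat I a b) (mixPat I b a) = a := by
  ext i j
  simp only [mixPat_apply]
  split_ifs <;> rfl

lemma mul_apply_congr_row {a b c : Mat n F} {i : Fin n} (h : ∀ k, a i k = b i k) (j : Fin n) :
    (a * c) i j = (b * c) i j := by
  simp [Matrix.mul_apply, h]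

lemma mul_apply_congr_col {a b c : Mat n F} {j : Fin n} (h : ∀ k, a k j = b k j) (i : Fin n) :
    (c * a) i j = (c * b) i j := by
  simp [Matrix.mul_apply, h]

variable [Fintype F]

/-- The sum of `θ(-λ(axb))` over `a, b` in the pattern group is multiplicative in functionals
sharing no row and no column. -/
lemma sum_addChar_pairM_add (θ : AddChar F ℂ) (mu nu x : Mat n F)
    (hrow : ∀ i : Fin n, (∃ j, mu i j ≠ 0) → ∀ j, nu i j = 0)
    (hcol : ∀ j : Fin n, (∃ i, mu i j ≠ 0) → ∀ i, nu i j = 0) :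
    (Fintype.card (patGroup P : Set (Mat n F)) : ℂ) ^ 2 *
        ∑ a : (patGroup P : Set (Mat n F)), ∑ b : (patGroup P : Set (Mat n F)),
          θ (-pairM (mu + nu) (a.1 * x * b.1)) =
      (∑ a : (patGroup P : Set (Mat n F)), ∑ b : (patGroup P : Set (Mat n F)),
          θ (-pairM mu (a.1 * x * b.1))) *
        ∑ a : (patGroup P : Set (Mat n F)), ∑ b : (patGroup P : Set (Mat n F)),
          θ (-pairM nu (a.1 * x * b.1)) := by
  have hcols : ∀ y : Mat n F, (Fintype.card (patGroup P : Set (Mat n F)) : ℂ) *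
      ∑ b : (patGroup P : Set (Mat n F)), θ (-pairM (mu + nu) (y * b.1)) =
      (∑ b : (patGroup P : Set (Mat n F)), θ (-pairM mu (y * b.1))) *
        ∑ b : (patGroup P : Set (Mat n F)), θ (-pairM nu (y * b.1)) := by
    intro y
    rw [← card_mul_sum_mul_of_mix (mixPat fun _ j => ∃ i, mu i j ≠ 0) (mixPat_mixPat _)]
    · simp only [pairM_add_left, neg_add, AddChar.map_add_eq_mul]
    · intro a b
      rw [pairM_congr (y := y * a.1)]
      intro i j hij
      exact mul_apply_congr_col (fun k => by rw [mixPat_apply, if_pos ⟨i, hij⟩]) i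
    · intro a b
      rw [pairM_congr (y := y * b.1)]
      intro i j hij
      exact mul_apply_congr_col
        (fun k => by rw [mixPat_apply, if_neg fun h => hij (hcol j h i)]) i
  rw [sq, mul_assoc, Finset.mul_sum, Finset.sum_congr rfl fun a _ => hcols (a.1 * x)]
  refine card_mul_sum_mul_of_mix (mixPat fun i _ => ∃ j, mu i j ≠ 0) (mixPat_mixPat _)
    (fun a => ∑ b : (patGroup P : Set (Mat n F)), θ (-pairM mu (a.1 * x * b.1)))
    (fun a => ∑ b : (patGroup P : Set (Mat n F)), θ (-pairM nu (a.1 * x * b.1))) ?_ ?_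
  · intro a a'
    refine Finset.sum_congr rfl fun b _ => ?_
    rw [pairM_congr (y := a.1 * x * b.1)]
    intro i j hij
    simp only [Matrix.mul_assoc]
    exact mul_apply_congr_row (fun k => by rw [mixPat_apply, if_pos ⟨j, hij⟩]) j
  · intro a a'
    refine Finset.sum_congr rfl fun b _ => ?_
    rw [pairM_congr (y := a'.1 * x * b.1)]
    intro i j hij
    simp only [Matrix.mul_assoc]
    exact mul_apply_congr_row
      (fun k => by rw [mixPat_apply, if_neg fun h => hij (hrow i h j)]) j

/-- The supercharacter as an average over pairs of elements of the pattern group. -/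
lemma superChar_eq (hP1 : ∀ i j : Fin n, P i j → i < j)
    (hP2 : ∀ i j k : Fin n, P i j → P j k → P i k) (θ : AddChar F ℂ) (lam : Mat n F)
    {u : Mat n F} (hu : u ∈ (patGroup P : Set (Mat n F))) :
    superChar P θ lam u = ((dualLeftOrbit P lam).ncard : ℂ) *
      ((∑ a : (patGroup P : Set (Mat n F)), ∑ b : (patGroup P : Set (Mat n F)),
          θ (-pairM lam (a.1 * (u - 1) * b.1))) /
        (Fintype.card (patGroup P : Set (Mat n F)) : ℂ) ^ 2) := by
  let U := (patGroup P : Set (Mat n F))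
  let _ : Group U := patGroupGroup hP1 hP2
  let φ : U × U → Mat n F := fun p => truncP P ((p.1.1⁻¹)ᵀ * lam * p.2.1ᵀ)
  have hinv : ∀ a : U, (a⁻¹).1 = a.1⁻¹ := fun _ => rfl
  have hmul : ∀ a b : U, (a * b).1 = a.1 * b.1 := fun _ _ => rfl
  have hx : ∀ i j, ¬ P i j → (u - 1) i j = 0 := by
    intro i j hij
    by_cases h : i = j
    · subst h; simp [hu.1]
    · simp [hu.2 i j h hij, h]
  have horbit : dualOrbit P lam = ↑(Finset.univ.image φ) := by
    ext M
    simp only [dualOrbit, Set.mem_ofPred_eq, Finset.coe_image, Finset.coe_univ, Set.image_univ,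
      Set.mem_range, Prod.exists, φ]
    constructor
    · rintro ⟨a, ha, b, hb, rfl⟩
      exact ⟨⟨a, ha⟩, ⟨b⁻¹, inv_mem_patGroup hP1 hP2 hb⟩, rfl⟩
    · rintro ⟨a, b, rfl⟩
      refine ⟨a.1, a.2, (b⁻¹).1, (b⁻¹).2, ?_⟩
      rw [← hinv b⁻¹, inv_inv]
  have hφ : ∀ k g h, φ g = φ h → φ (k * g) = φ (k * h) := by
    intro k g h hgh
    have := truncP_mul_mul_congr hP2 (k.1⁻¹).2 k.2.2 hgh
    simp only [φ, Prod.fst_mul, Prod.snd_mul, ← hinv, _root_.mul_inv_rev, hmul,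
      Matrix.transpose_mul]
    simpa only [← hinv, Matrix.mul_assoc] using this
  have hsum := sum_comp_mul_card_image φ hφ fun M => θ (-pairM M (u - 1))
  have hsum' : ∑ p : U × U, θ (-pairM (φ p) (u - 1)) =
      ∑ a : U, ∑ b : U, θ (-pairM lam (a.1 * (u - 1) * b.1)) := by
    rw [Fintype.sum_prod_type, ← Equiv.sum_comp (Equiv.inv U)]
    refine Finset.sum_congr rfl fun a _ => Finset.sum_congr rfl fun b _ => ?_
    simp only [φ, pairM_truncP hx, pairM_transpose_mul_mul, Equiv.inv_apply, ← hinv, inv_inv]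
  rw [hsum', Fintype.card_prod] at hsum
  have h1 : ((Finset.univ.image φ).card : ℂ) ≠ 0 := by
    simp [Finset.card_eq_zero, Finset.univ_eq_empty_iff]
  have h2 : (Fintype.card U : ℂ) ≠ 0 := by simp
  rw [superChar, horbit, Set.ncard_coe_finset, finsum_mem_coe_finset, div_mul_eq_mul_div,
    mul_div_assoc]
  congr 1
  rw [div_eq_div_iff h1 (pow_ne_zero 2 h2)]
  push_cast at hsum
  linear_combination -hsum

lemma mem_dualLeftOrbit_iff (hP1 : ∀ i j : Fin n, P i j → i < j)
    (hP2 : ∀ i j k : Fin n, P i j → P j k → P i k) {lam M : Mat n F} :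
    M ∈ dualLeftOrbit P lam ↔
      ∃ a : (patGroup P : Set (Mat n F)), M = truncP P (a.1ᵀ * lam) := by
  constructor
  · rintro ⟨a, ha, rfl⟩
    exact ⟨⟨a⁻¹, inv_mem_patGroup hP1 hP2 ha⟩, rfl⟩
  · rintro ⟨a, rfl⟩
    refine ⟨a.1⁻¹, inv_mem_patGroup hP1 hP2 a.2, ?_⟩
    rw [Matrix.nonsing_inv_nonsing_inv _ (by simp [det_eq_one_of_mem_patGroup hP1 a.2])]

/-- Left orbit sizes are multiplicative in functionals sharing no row and no column. -/
lemma ncard_dualLeftOrbit_add (hP1 : ∀ i j : Fin n, P i j → i < j)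
    (hP2 : ∀ i j k : Fin n, P i j → P j k → P i k) (mu nu : Mat n F)
    (hrow : ∀ i : Fin n, (∃ j, mu i j ≠ 0) → ∀ j, nu i j = 0)
    (hcol : ∀ j : Fin n, (∃ i, mu i j ≠ 0) → ∀ i, nu i j = 0) :
    (dualLeftOrbit P (mu + nu)).ncard =
      (dualLeftOrbit P mu).ncard * (dualLeftOrbit P nu).ncard := by
  have hsupp : ∀ lam M : Mat n F, M ∈ dualLeftOrbit P lam →
      ∀ j, (∀ i, lam i j = 0) → ∀ i, M i j = 0 := by
    rintro lam M ⟨a, -, rfl⟩ j hj i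
    simp [truncP, Matrix.mul_apply, hj]
  have hadd : ∀ A B : Mat n F, truncP P (A + B) = truncP P A + truncP P B := by
    intro A B
    ext i j
    by_cases h : P i j <;> simp [truncP, h]
  have himage : dualLeftOrbit P (mu + nu) =
      (fun p : Mat n F × Mat n F => p.1 + p.2) '' (dualLeftOrbit P mu ×ˢ dualLeftOrbit P nu) := by
    ext M
    simp only [Set.mem_image, Set.mem_prod, Prod.exists, mem_dualLeftOrbit_iff hP1 hP2]
    constructor
    · rintro ⟨a, rfl⟩
      exact ⟨_, _, ⟨⟨a, rfl⟩, ⟨a, rfl⟩⟩, by rw [Matrix.mul_add, hadd]⟩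
    · rintro ⟨_, _, ⟨⟨a, rfl⟩, ⟨b, rfl⟩⟩, rfl⟩
      refine ⟨mixPat (fun i _ => ∃ j, mu i j ≠ 0) a b, ?_⟩
      rw [Matrix.mul_add, hadd]
      congr 2
      · ext i j
        simp only [Matrix.mul_apply, Matrix.transpose_apply, mixPat_apply]
        refine Finset.sum_congr rfl fun k _ => ?_
        split_ifs with h
        · rfl
        · push Not at h
          simp [h j]
      · ext i j
        simp only [Matrix.mul_apply, Matrix.transpose_apply, mixPat_apply]
        refine Finset.sum_congr rfl fun k _ => ?_
        split_ifs with h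
        · simp [hrow k h j]
        · rfl
  rw [himage, Set.InjOn.ncard_image, Set.ncard_prod]
  rintro ⟨A, B⟩ ⟨hA, hB⟩ ⟨A', B'⟩ ⟨hA', hB'⟩ h
  dsimp only at hA hB hA' hB'
  have hentry : ∀ i j, A i j + B i j = A' i j + B' i j := fun i j => congrFun (congrFun h i) j
  have key : ∀ i j, A i j = A' i j ∧ B i j = B' i j := by
    intro i j
    have hij := hentry i j
    by_cases hj : ∃ i, mu i j ≠ 0
    · simpa [hsupp _ _ hB j (hcol j hj) i, hsupp _ _ hB' j (hcol j hj) i] using hij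
    · push Not at hj
      simpa [hsupp _ _ hA j hj i, hsupp _ _ hA' j hj i] using hij
  exact Prod.ext (Matrix.ext fun i j => (key i j).1) (Matrix.ext fun i j => (key i j).2)

end Helpers

/-- If `λ = μ + ν` in `𝔫_P^*` with `μ` and `ν` sharing no row and no column
of nonzero entries, then `χ^λ(u) = χ^μ(u) · χ^ν(u)` for all `u ∈ U_P`. -/
theorem stmt10 {n : ℕ} {F : Type*} [Field F] [Fintype F]
    (P : Fin n → Fin n → Prop)
    (hP1 : ∀ i j : Fin n, P i j → i < j)
    (hP2 : ∀ i j k : Fin n, P i j → P j k → P i k)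
    (θ : AddChar F ℂ) (hθ : ∃ x, θ x ≠ 1)
    (lam mu nu : Mat n F)
    (hmu : ∀ i j : Fin n, ¬ P i j → mu i j = 0)
    (hnu : ∀ i j : Fin n, ¬ P i j → nu i j = 0)
    (hsum : lam = mu + nu)
    (hrow : ∀ i : Fin n, (∃ j, mu i j ≠ 0) → ∀ j, nu i j = 0)
    (hcol : ∀ j : Fin n, (∃ i, mu i j ≠ 0) → ∀ i, nu i j = 0) :
    ∀ u ∈ (patGroup P : Set (Mat n F)),
      superChar P θ lam u = superChar P θ mu u * superChar P θ nu u := by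
  intro u hu
  subst hsum
  have : Nonempty (patGroup P : Set (Mat n F)) := ⟨⟨1, one_mem_patGroup⟩⟩
  have hc : (Fintype.card (patGroup P : Set (Mat n F)) : ℂ) ≠ 0 := by simp
  have hsum := sum_addChar_pairM_add (P := P) θ mu nu (u - 1) hrow hcol
  rw [superChar_eq hP1 hP2 θ _ hu, superChar_eq hP1 hP2 θ _ hu, superChar_eq hP1 hP2 θ _ hu,
    ncard_dualLeftOrbit_add hP1 hP2 mu nu hrow hcol, mul_mul_mul_comm, div_mul_div_comm, ← hsum,
    mul_div_mul_left _ _ (pow_ne_zero 2 hc)]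
  push_cast
  ring
end
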